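/- arXiv:2012.09437 — 3 statements merged into one kernel-verified Lean document; each statement's English description precedes it below -/
import Mathlib

section
/- Under Assumptions 1–5 in the explicit specialization with K = 1 and α > 0, set δ := α/2. Then there exist constants C > 0 and M > 0 such that for every integer n ≥ 1 and every integer j with n δ ≤ j ≤ n r, the temporal Green's function satisfies |𝒢ⁿ_j| ≤ (C / n^{1/(2μ)}) exp( −(1/M) ( |j − α n| / n^{1/(2μ)} )^{ 2μ/(2μ−1) } ). -/
open scoped Classical
open Complex Filter Asymptotics Metric

noncomputable section

set_option autoImplicit false

/-- the space `ℓ²(ℤ;ℂ)` -/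
abbrev Seq2 : Type := lp (fun _ : ℤ => ℂ) 2

/-- the action of the convolution operator with coefficients `a` supported in `{-r, …, p}`:
`(Q u)_j = ∑_{ℓ=-r}^p a_ℓ u_{j+ℓ}`. -/
def convAct (r p : ℕ) (a : ℤ → ℂ) (u : ℤ → ℂ) (j : ℤ) : ℂ :=
  ∑ ℓ ∈ Finset.Icc (-(r : ℤ)) (p : ℤ), a ℓ * u (j + ℓ)

/-- the symbol `Q̂(κ) = ∑_{ℓ=-r}^p a_ℓ κ^ℓ`. -/
def symbol (r p : ℕ) (a : ℤ → ℂ) (κ : ℂ) : ℂ :=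
  ∑ ℓ ∈ Finset.Icc (-(r : ℤ)) (p : ℤ), a ℓ * κ ^ ℓ

/-- the symbol `F = Q̂₀ / Q̂₁` of the operator `ℒ = Q₁⁻¹ Q₀`. -/
def Fsym (r p : ℕ) (a0 a1 : ℤ → ℂ) (κ : ℂ) : ℂ :=
  symbol r p a0 κ / symbol r p a1 κ

/-- `𝔸_ℓ(z) = z a_{ℓ,1} - a_{ℓ,0}`. -/
def Acoef (a0 a1 : ℤ → ℂ) (ℓ : ℤ) (z : ℂ) : ℂ := z * a1 ℓ - a0 ℓ

/-- the companion-type matrix `𝕄(z) ∈ M_{p+r}(ℂ)`: first row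
`(-𝔸_{p-1}(z)/𝔸_p(z), …, -𝔸_{-r}(z)/𝔸_p(z))`, ones on the subdiagonal, zeros elsewhere. -/
def Mmat (r p : ℕ) (a0 a1 : ℤ → ℂ) (z : ℂ) : Matrix (Fin (p + r)) (Fin (p + r)) ℂ :=
  fun i j =>
    if (i : ℕ) = 0 then - Acoef a0 a1 ((p : ℤ) - 1 - (j : ℕ)) z / Acoef a0 a1 (p : ℤ) z
    else if (i : ℕ) = (j : ℕ) + 1 then 1 else 0

/-- the discrete Dirac mass `δ ∈ ℓ²(ℤ;ℂ)`. -/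
def dirac : Seq2 := lp.single 2 (0 : ℤ) (1 : ℂ)

lemma tg_order (E : ℂ → ℂ) (m : ℕ) (hE : AnalyticAt ℂ E 0)
    (hO : (fun ξ : ℝ => E ξ) =O[nhds 0] fun ξ : ℝ => ξ ^ m) :
    ∃ C > (0:ℝ), ∃ ρ > (0:ℝ), ∀ w : ℂ, ‖w‖ < ρ → ‖E w‖ ≤ C * ‖w‖ ^ m := by
  have key : E =O[nhds 0] fun w : ℂ => w ^ m := by
    by_cases htop : analyticOrderAt E 0 = ⊤
    · rw [analyticOrderAt_eq_top] at htop
      exact (EventuallyEq.isBigO htop).trans (isBigO_zero _ _)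
    · obtain ⟨k, hk⟩ := ENat.ne_top_iff_exists.1 htop
      obtain ⟨g, hg, hg0, hEg⟩ := (hE.analyticOrderAt_eq_natCast).1 hk.symm
      have hgc : Tendsto (fun ξ : ℝ => g ξ) (nhds 0) (nhds (g 0)) := by
        have h1 : Tendsto (fun ξ : ℝ => (ξ:ℂ)) (nhds 0) (nhds 0) := by
          simpa using (Complex.continuous_ofReal.tendsto (0:ℝ))
        exact hg.continuousAt.tendsto.comp h1
      have hEr : ∀ᶠ ξ : ℝ in nhds 0, E ξ = (ξ:ℂ) ^ k * g ξ := by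
        have h1 : Tendsto (fun ξ : ℝ => (ξ:ℂ)) (nhds 0) (nhds 0) := by
          simpa using (Complex.continuous_ofReal.tendsto (0:ℝ))
        have := h1.eventually hEg
        simpa using this
      have hmk : m ≤ k := by
        by_contra hlt
        push Not at hlt
        obtain ⟨C, hC⟩ := hO.bound
        have h3 : ∀ᶠ ξ : ℝ in nhdsWithin 0 (Set.Ioi 0), ‖g ξ‖ ≤ C * ξ ^ (m - k) := by
          filter_upwards [nhdsWithin_le_nhds hC, nhdsWithin_le_nhds hEr,
            self_mem_nhdsWithin] with ξ h1 h2 h3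
          have h3' : 0 < ξ := h3
          rw [h2, norm_mul, norm_pow, Complex.norm_real, Real.norm_of_nonneg h3'.le,
            norm_pow, Real.norm_of_nonneg h3'.le] at h1
          have : ξ ^ m = ξ ^ k * ξ ^ (m - k) := by rw [← pow_add]; congr 1; omega
          rw [this] at h1
          have hp : 0 < ξ ^ k := by positivity
          have : ξ ^ k * ‖g ξ‖ ≤ ξ ^ k * (C * ξ ^ (m - k)) := by linarith
          exact le_of_mul_le_mul_left this hp
        have h4 : Tendsto (fun ξ : ℝ => C * ξ ^ (m - k)) (nhdsWithin 0 (Set.Ioi 0)) (nhds 0) := by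
          have : Tendsto (fun ξ : ℝ => C * ξ ^ (m - k)) (nhds 0) (nhds (C * 0 ^ (m-k))) :=
            (Continuous.tendsto (by fun_prop) 0)
          rw [zero_pow (by omega), mul_zero] at this
          exact this.mono_left nhdsWithin_le_nhds
        have h5 := le_of_tendsto_of_tendsto (hgc.norm.mono_left nhdsWithin_le_nhds) h4 h3
        exact hg0 (norm_le_zero_iff.1 h5)
      have hEg' : E =ᶠ[nhds 0] fun w => w ^ k * g w := by
        filter_upwards [hEg] with w hw
        simpa using hw
      refine hEg'.trans_isBigO ?_
      have h1 : g =O[nhds 0] (fun _ => (1:ℂ)) := hg.continuousAt.isBigO_one ℂ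
      have h2 : (fun w : ℂ => w ^ k) =O[nhds 0] fun w => w ^ m := by
        have : (fun w : ℂ => w ^ (k - m)) =O[nhds 0] (fun _ => (1:ℂ)) :=
          (Continuous.continuousAt (by fun_prop)).isBigO_one ℂ
        have := this.mul (isBigO_refl (fun w : ℂ => w ^ m) (nhds 0))
        refine this.congr' ?_ ?_
        · refine Eventually.of_forall fun w => ?_
          simp only
          rw [← pow_add]; congr 1; omega
        · refine Eventually.of_forall fun w => by simp
      simpa using h2.mul h1
  obtain ⟨C, hC0, hC⟩ := key.exists_pos
  obtain ⟨ρ, hρ, h⟩ := Metric.eventually_nhds_iff.1 hC.bound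
  refine ⟨C, hC0, ρ, hρ, fun w hw => ?_⟩
  have := h (y := w) (by simpa using hw)
  simpa using this

lemma tg_re (m : ℕ) : ∃ C > (0:ℝ), ∀ ξ η : ℝ,
    (1/2) * ξ ^ (2*m) - C * η ^ (2*m) ≤ (((ξ:ℂ) + I * η) ^ (2*m)).re := by
  have hc : ContinuousAt (fun θ : ℝ => (((1:ℂ) + I * θ) ^ (2*m)).re) 0 :=
    Continuous.continuousAt (by fun_prop)
  have h1 : ∀ᶠ θ : ℝ in nhds 0, (1/2:ℝ) < (((1:ℂ) + I * θ) ^ (2*m)).re := by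
    apply hc.eventually (lt_mem_nhds _)
    simp; norm_num
  obtain ⟨t, ht, h⟩ := Metric.eventually_nhds_iff.1 h1
  refine ⟨(1/t + 1) ^ (2*m) + (1/t)^(2*m), by positivity, fun ξ η => ?_⟩
  have ev : ∀ x : ℝ, x ^ (2*m) = |x| ^ (2*m) := fun x => by
    rw [Even.pow_abs (even_two_mul m)]
  by_cases hcase : |η| < t * |ξ|
  · have hξ : ξ ≠ 0 := by
      rintro rfl
      simp at hcase
      exact absurd hcase (not_lt.2 (abs_nonneg _))
    have hθ : |η / ξ| < t := by
      rw [abs_div, div_lt_iff₀ (abs_pos.2 hξ)]; exact hcase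
    have h2 := h (y := η / ξ) (by rw [dist_zero_right, Real.norm_eq_abs]; exact hθ)
    have h3 : ((ξ:ℂ) + I * η) ^ (2*m) = ((ξ ^ (2*m) : ℝ) : ℂ) * ((1:ℂ) + I * ((η/ξ : ℝ):ℂ)) ^ (2*m) := by
      push_cast
      rw [← mul_pow]
      congr 1
      have : (ξ:ℂ) ≠ 0 := by exact_mod_cast hξ
      field_simp
    rw [h3, Complex.re_ofReal_mul]
    have h4 : 0 ≤ ξ ^ (2*m) := by rw [ev]; positivity
    have h5 : 0 ≤ η ^ (2*m) := by rw [ev]; positivity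
    have h6 : 0 ≤ ((1/t + 1) ^ (2*m) + (1/t)^(2*m)) * η ^ (2*m) := by positivity
    nlinarith
  · push Not at hcase
    have hξ : |ξ| ≤ 1/t * |η| := by
      rw [div_mul_eq_mul_div, le_div_iff₀ ht]; linarith
    have h2 : ‖((ξ:ℂ) + I * η)‖ ≤ (1/t + 1) * |η| := by
      calc ‖((ξ:ℂ) + I * η)‖ ≤ ‖(ξ:ℂ)‖ + ‖I * (η:ℂ)‖ := norm_add_le _ _
        _ = |ξ| + |η| := by simp
        _ ≤ _ := by linarith
    have h3 : ‖((ξ:ℂ) + I * η) ^ (2*m)‖ ≤ (1/t + 1) ^ (2*m) * η ^ (2*m) := by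
      rw [norm_pow, ev η, ← mul_pow]
      exact pow_le_pow_left₀ (norm_nonneg _) h2 _
    have h4 := (abs_le.1 (Complex.abs_re_le_norm (((ξ:ℂ) + I * η) ^ (2*m)))).1
    have h5 : ξ ^ (2*m) ≤ (1/t)^(2*m) * η ^ (2*m) := by
      rw [ev ξ, ev η, ← mul_pow]
      exact pow_le_pow_left₀ (abs_nonneg _) hξ _
    have h6 : 0 ≤ ξ ^ (2*m) := by rw [ev]; positivity
    linarith

lemma tg_int (m : ℕ) (hm : 1 ≤ m) (c : ℝ) (hc : 0 < c) : ∃ K > (0:ℝ), ∀ s : ℝ, 0 < s →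
    ∫ ξ in (-Real.pi)..Real.pi, Real.exp (-c * (s * ξ) ^ (2*m)) ≤ K / s := by
  refine ⟨(2 + 1/c) * Real.pi, by positivity, fun s hs => ?_⟩
  have hpt : ∀ x : ℝ, Real.exp (-c * x ^ (2*m)) ≤ (2 + 1/c) * (1 + x^2)⁻¹ := by
    intro x
    rw [← div_eq_mul_inv, le_div_iff₀ (by positivity)]
    set y := x ^ (2*m) with hy
    have hy0 : 0 ≤ y := by rw [hy, pow_mul]; positivity
    have h1 : x ^ 2 ≤ 1 + y := by
      rw [hy, pow_mul]
      rcases le_total (x^2) 1 with h | h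
      · have : 0 ≤ (x^2)^m := by positivity
        linarith
      · have := le_self_pow₀ h (show m ≠ 0 by omega)
        linarith
    have h2 : Real.exp (-c*y) ≤ 1 := Real.exp_le_one_iff.2 (by nlinarith)
    have h3 : Real.exp (-c*y) * y ≤ 1/c := by
      rw [le_div_iff₀ hc]
      have h4 := Real.add_one_le_exp (c*y)
      have h5 : Real.exp (-c*y) * Real.exp (c*y) = 1 := by
        rw [← Real.exp_add]; simp
      have h6 := Real.exp_pos (-c*y)
      nlinarith
    have h6 := Real.exp_pos (-c*y)
    nlinarith
  rw [intervalIntegral.integral_comp_mul_left (fun x => Real.exp (-c * x ^ (2*m))) hs.ne']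
  have hpi := Real.pi_pos
  have : ∫ x in (s * -Real.pi)..(s * Real.pi), Real.exp (-c * x ^ (2*m)) ≤
      ∫ x in (s * -Real.pi)..(s * Real.pi), (2 + 1/c) * (1 + x^2)⁻¹ := by
    apply intervalIntegral.integral_mono_on
    · nlinarith
    · exact Continuous.intervalIntegrable (by fun_prop) _ _
    · refine Continuous.intervalIntegrable ?_ _ _
      have : ∀ x : ℝ, 1 + x^2 ≠ 0 := fun x => by positivity
      fun_prop (disch := assumption)
    · intro x _; exact hpt x
  rw [intervalIntegral.integral_const_mul, integral_inv_one_add_sq] at this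
  have h7 : Real.arctan (s * Real.pi) - Real.arctan (s * -Real.pi) ≤ Real.pi := by
    have := Real.arctan_lt_pi_div_two (s * Real.pi)
    have := Real.neg_pi_div_two_lt_arctan (s * -Real.pi)
    linarith
  rw [smul_eq_mul, div_eq_inv_mul]
  apply mul_le_mul_of_nonneg_left _ (by positivity)
  exact this.trans (mul_le_mul_of_nonneg_left h7 (by positivity))

lemma tg_green (r p : ℕ) (a : ℤ → ℂ) (G : ℕ → ℤ → ℂ)
    (h0 : ∀ j, G 0 j = if j = 0 then 1 else 0)
    (hs : ∀ n j, G (n+1) j = convAct r p a (G n) j) (η : ℝ) (n : ℕ) : ∀ j : ℤ,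
    2 * Real.pi * G n j = ∫ ξ in (-Real.pi)..Real.pi,
      symbol r p a (exp (I * ((ξ:ℂ) + I * η))) ^ n * exp (I * ((ξ:ℂ) + I * η)) ^ j := by
  have hne : ∀ ξ : ℝ, exp (I * ((ξ:ℂ) + I * η)) ≠ 0 := fun ξ => Complex.exp_ne_zero _
  have hcz : ∀ j : ℤ, Continuous fun ξ : ℝ => exp (I * ((ξ:ℂ) + I * η)) ^ j := by
    intro j
    exact Continuous.zpow₀ (by fun_prop) j (fun ξ => Or.inl (hne ξ))
  have hcs : Continuous fun ξ : ℝ => symbol r p a (exp (I * ((ξ:ℂ) + I * η))) := by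
    unfold symbol
    exact continuous_finsetSum _ fun l _ => continuous_const.mul (hcz l)
  induction n with
  | zero =>
    intro j
    rw [h0]
    have h1 : ∀ ξ : ℝ, symbol r p a (exp (I * ((ξ:ℂ) + I * η))) ^ 0 * exp (I * ((ξ:ℂ) + I * η)) ^ j
      = exp (-(j*η)) * exp ((I * j) * ξ) := by
      intro ξ
      rw [pow_zero, one_mul, ← Complex.exp_int_mul, ← Complex.exp_add]
      congr 1
      linear_combination (j:ℂ) * η * I_mul_I
    simp_rw [h1]
    rw [intervalIntegral.integral_const_mul]
    by_cases hj : j = 0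
    · subst hj
      simp
      ring
    · rw [if_neg hj, integral_exp_mul_complex]
      · have h2 : exp (I * j * (Real.pi:ℝ)) = exp (I * j * ((-Real.pi : ℝ):ℂ)) := by
          rw [Complex.exp_eq_exp_iff_exists_int]
          exact ⟨j, by push_cast; ring⟩
        rw [h2]; simp
      · simp [hj]
  | succ n ih =>
    intro j
    rw [hs, convAct, Finset.mul_sum]
    have h1 : ∀ l : ℤ, 2 * (Real.pi:ℂ) * (a l * G n (j + l)) = ∫ ξ in (-Real.pi)..Real.pi,
      a l * (symbol r p a (exp (I * ((ξ:ℂ) + I * η))) ^ n * exp (I * ((ξ:ℂ) + I * η)) ^ (j+l)) := by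
      intro l
      rw [intervalIntegral.integral_const_mul, ← ih]
      ring
    simp_rw [h1]
    rw [← intervalIntegral.integral_finsetSum]
    · apply intervalIntegral.integral_congr
      intro ξ _
      simp only
      have e : symbol r p a (exp (I * ((ξ:ℂ) + I * η))) ^ (n+1) =
          symbol r p a (exp (I * ((ξ:ℂ) + I * η))) ^ n *
          ∑ ℓ ∈ Finset.Icc (-(r : ℤ)) (p : ℤ), a ℓ * exp (I * ((ξ:ℂ) + I * η)) ^ ℓ := by
        rw [pow_succ]; rfl
      rw [e, mul_assoc, Finset.sum_mul, Finset.mul_sum]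
      apply Finset.sum_congr rfl
      intro l _
      rw [zpow_add₀ (hne ξ)]
      ring
    · intro l _
      exact (continuous_const.mul ((hcs.pow n).mul (hcz (j+l)))).intervalIntegrable _ _


lemma tg_near (f : ℂ → ℂ) (hf : Differentiable ℂ f) (α β : ℝ) (hβ : 0 < β) (μ : ℕ)
    (hexp : ∃ g : ℝ → ℂ, (g =O[nhds 0] fun ξ : ℝ => ξ ^ (2 * μ + 1)) ∧
      ∀ᶠ ξ : ℝ in nhds 0, f ξ =
        Complex.exp (-(Complex.I) * (α : ℂ) * (ξ : ℂ)
          - (β : ℂ) * (ξ : ℂ) ^ (2 * μ) + g ξ)) :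
    ∃ C > (0:ℝ), ∃ ρ > (0:ℝ), ∀ ξ η : ℝ, |ξ| ≤ ρ → |η| ≤ ρ →
      ‖f ((ξ:ℂ) + I * η)‖ ≤ Real.exp (α * η - β/4 * ξ ^ (2*μ) + C * η ^ (2*μ)) := by
  obtain ⟨g, hg, hfg⟩ := hexp
  set E : ℂ → ℂ := fun w => f w * exp (I * α * w + β * w ^ (2*μ)) - 1 with hE
  have hEd : Differentiable ℂ E := by
    apply Differentiable.sub_const
    apply hf.mul
    fun_prop
  have hg0 : Tendsto g (nhds 0) (nhds 0) := by
    apply hg.trans_tendsto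
    have : Tendsto (fun ξ : ℝ => ξ ^ (2*μ+1)) (nhds 0) (nhds (0 ^ (2*μ+1))) :=
      Continuous.tendsto (by fun_prop) 0
    simpa using this
  have hEO : (fun ξ : ℝ => E ξ) =O[nhds 0] fun ξ : ℝ => ξ ^ (2*μ+1) := by
    refine IsBigO.trans ?_ hg
    have h1 : (fun ξ : ℝ => E ξ) =ᶠ[nhds 0] fun ξ => exp (g ξ) - 1 := by
      filter_upwards [hfg] with ξ h
      simp only [hE]
      rw [h, ← Complex.exp_add]
      congr 2; ring
    refine h1.trans_isBigO ?_
    refine IsBigO.of_bound 2 ?_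
    have h2 : ∀ᶠ ξ in nhds 0, ‖g ξ‖ < 1 := by
      have := hg0.norm
      rw [norm_zero] at this
      exact this.eventually (gt_mem_nhds one_pos)
    filter_upwards [h2] with ξ h
    exact Complex.norm_exp_sub_one_le h.le
  obtain ⟨C0, hC0, ρ0, hρ0, hb⟩ := tg_order E (2*μ+1) (hEd.analyticAt 0) hEO
  obtain ⟨C1, hC1, hre⟩ := tg_re μ
  set A : ℝ := C0 * 2 ^ (2*μ) with hA
  have hA0 : 0 < A := by positivity
  refine ⟨β * C1 + β/4, by positivity, min (ρ0/4) (β / (8 * A)), by positivity, ?_⟩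
  intro ξ η hξ hη
  set w : ℂ := (ξ:ℂ) + I * η with hw
  have hwn : ‖w‖ ≤ |ξ| + |η| := by
    calc ‖w‖ ≤ ‖(ξ:ℂ)‖ + ‖I * (η:ℂ)‖ := norm_add_le _ _
        _ = |ξ| + |η| := by simp
  have hm1 := min_le_left (ρ0/4) (β / (8 * A))
  have hm2 := min_le_right (ρ0/4) (β / (8 * A))
  have hEw := hb w (by linarith)
  have hfw : f w = exp (-(I * α * w + β * w ^ (2*μ))) * (1 + E w) := by
    have : exp (-(I * α * w + β * w ^ (2*μ))) * exp (I * α * w + β * w ^ (2*μ)) = 1 := by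
      rw [← Complex.exp_add]; simp
    simp only [hE]
    linear_combination (-f w) * this
  have ev : ∀ x : ℝ, x ^ (2*μ) = |x| ^ (2*μ) := fun x => by
    rw [Even.pow_abs (even_two_mul μ)]
  have hpow : ‖w‖ ^ (2*μ) ≤ 2 ^ (2*μ) * (ξ ^ (2*μ) + η ^ (2*μ)) := by
    have h1 : ‖w‖ ≤ 2 * max |ξ| |η| := by
      have := le_max_left |ξ| |η|
      have := le_max_right |ξ| |η|
      linarith
    have h2 := pow_le_pow_left₀ (norm_nonneg w) h1 (2*μ)
    rw [mul_pow] at h2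
    refine h2.trans (mul_le_mul_of_nonneg_left ?_ (by positivity))
    rw [ev ξ, ev η]
    rcases max_cases |ξ| |η| with ⟨h, _⟩ | ⟨h, _⟩ <;> rw [h]
    · have : 0 ≤ |η| ^ (2*μ) := by positivity
      linarith
    · have : 0 ≤ |ξ| ^ (2*μ) := by positivity
      linarith
  have hEfin : ‖E w‖ ≤ β/4 * (ξ ^ (2*μ) + η ^ (2*μ)) := by
    have h1 : ‖w‖ ≤ 2 * (β / (8*A)) := by linarith
    have hs : 0 ≤ ξ ^ (2*μ) + η ^ (2*μ) := by rw [ev ξ, ev η]; positivity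
    calc ‖E w‖ ≤ C0 * ‖w‖ ^ (2*μ+1) := hEw
      _ = C0 * ‖w‖ ^ (2*μ) * ‖w‖ := by rw [pow_succ]; ring
      _ ≤ C0 * (2 ^ (2*μ) * (ξ ^ (2*μ) + η ^ (2*μ))) * (2 * (β / (8*A))) := by gcongr
      _ = A * (2 * (β / (8*A))) * (ξ ^ (2*μ) + η ^ (2*μ)) := by rw [hA]; ring
      _ = _ := by
        congr 1
        field_simp; norm_num
  have h1E : ‖1 + E w‖ ≤ Real.exp (β/4 * (ξ ^ (2*μ) + η ^ (2*μ))) := by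
    calc ‖1 + E w‖ ≤ ‖(1:ℂ)‖ + ‖E w‖ := norm_add_le _ _
      _ ≤ β/4 * (ξ ^ (2*μ) + η ^ (2*μ)) + 1 := by rw [norm_one]; linarith
      _ ≤ _ := Real.add_one_le_exp _
  rw [hfw, norm_mul, Complex.norm_exp]
  have hR : (-(I * α * w + β * w ^ (2*μ))).re = α * η - β * (w ^ (2*μ)).re := by
    rw [Complex.neg_re, Complex.add_re, Complex.re_ofReal_mul]
    have : (I * α * w).re = - (α * η) := by simp [hw]
    rw [this]; ring
  rw [hR]
  calc _ ≤ Real.exp (α * η - β * (w ^ (2*μ)).re) * Real.exp (β/4 * (ξ ^ (2*μ) + η ^ (2*μ))) := by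
        gcongr
    _ = Real.exp (α * η - β * (w ^ (2*μ)).re + β/4 * (ξ ^ (2*μ) + η ^ (2*μ))) := by
        rw [Real.exp_add]
    _ ≤ _ := by
        apply Real.exp_le_exp.2
        have := mul_le_mul_of_nonneg_left (hre ξ η) hβ.le
        nlinarith

lemma tg_key (f : ℂ → ℂ) (hf : Differentiable ℂ f) (α β : ℝ) (hβ : 0 < β) (μ : ℕ)
    (hlt : ∀ ξ : ℝ, |ξ| ≤ Real.pi → ξ ≠ 0 → ‖f ξ‖ < 1)
    (hexp : ∃ g : ℝ → ℂ, (g =O[nhds 0] fun ξ : ℝ => ξ ^ (2 * μ + 1)) ∧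
      ∀ᶠ ξ : ℝ in nhds 0, f ξ =
        Complex.exp (-(Complex.I) * (α : ℂ) * (ξ : ℂ)
          - (β : ℂ) * (ξ : ℂ) ^ (2 * μ) + g ξ)) :
    ∃ c > (0:ℝ), ∃ C > (0:ℝ), ∃ ρ > (0:ℝ), ∀ ξ η : ℝ, |ξ| ≤ Real.pi → |η| ≤ ρ →
      ‖f ((ξ:ℂ) + I * η)‖ ≤ Real.exp (α * η - c * ξ ^ (2*μ) + C * η ^ (2*μ)) := by
  obtain ⟨C, hC, ρ, hρ, hnear⟩ := tg_near f hf α β hβ μ hexp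
  have ev : ∀ x : ℝ, x ^ (2*μ) = |x| ^ (2*μ) := fun x => by
    rw [Even.pow_abs (even_two_mul μ)]
  set K : Set ℝ := {ξ | |ξ| ≤ Real.pi ∧ ρ ≤ |ξ|} with hK
  have hKc : IsCompact K := by
    have h1 : K = Set.Icc (-Real.pi) Real.pi ∩ {ξ | ρ ≤ |ξ|} := by
      ext ξ; simp [hK, abs_le]
    rw [h1]
    exact isCompact_Icc.inter_right (isClosed_le continuous_const continuous_abs)
  have hfc := hf.continuous
  obtain ⟨q, hq1, hq⟩ : ∃ q < (1:ℝ), ∀ ξ ∈ K, ‖f ξ‖ < q := by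
    rcases K.eq_empty_or_nonempty with h | h
    · exact ⟨0, one_pos, by simp [h]⟩
    · obtain ⟨x, hx, hmax⟩ := hKc.exists_isMaxOn h
        (f := fun ξ : ℝ => ‖f ξ‖) (Continuous.continuousOn (by fun_prop))
      have hx1 : ‖f x‖ < 1 := hlt x hx.1 (by
        rintro rfl
        have := hx.2
        simp at this; linarith)
      refine ⟨(1 + ‖f x‖)/2, by linarith, fun ξ hξ => ?_⟩
      have : ‖f ξ‖ ≤ ‖f x‖ := hmax hξ
      linarith
  have hev : ∀ᶠ η : ℝ in nhds 0, ∀ ξ ∈ K, ‖f ((ξ:ℂ) + I * η)‖ * Real.exp (-(α * η)) < q := by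
    apply hKc.eventually_forall_of_forall_eventually
    intro ξ hξ
    have hcont : Continuous fun z : ℝ × ℝ => ‖f ((z.2:ℂ) + I * z.1)‖ * Real.exp (-(α * z.1)) := by
      fun_prop
    have := hcont.continuousAt (x := ((0:ℝ), ξ))
    exact this.eventually (gt_mem_nhds (by simpa using hq ξ hξ))
  obtain ⟨ρ1, hρ1, h1⟩ := Metric.eventually_nhds_iff.1 hev
  obtain ⟨c', hc', hqc⟩ : ∃ c' > (0:ℝ), q ≤ Real.exp (-(c' * Real.pi ^ (2*μ))) := by
    have h2 : Tendsto (fun c : ℝ => Real.exp (-(c * Real.pi ^ (2*μ)))) (nhdsWithin 0 (Set.Ioi 0))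
        (nhds 1) := by
      have : Tendsto (fun c : ℝ => Real.exp (-(c * Real.pi ^ (2*μ)))) (nhds 0)
        (nhds (Real.exp (-(0 * Real.pi ^ (2*μ))))) := Continuous.tendsto (by fun_prop) 0
      simp only [zero_mul, neg_zero, Real.exp_zero] at this
      exact this.mono_left nhdsWithin_le_nhds
    obtain ⟨c, h3, h4⟩ := ((h2.eventually (lt_mem_nhds hq1)).and self_mem_nhdsWithin).exists
    exact ⟨c, h4, h3.le⟩
  refine ⟨min (β/4) c', by positivity, C, hC, min ρ (ρ1/2), by positivity, ?_⟩
  intro ξ η hξ hη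
  have hη1 : |η| ≤ ρ := hη.trans (min_le_left _ _)
  have hη2 : |η| < ρ1 := by have := hη.trans (min_le_right _ _); linarith
  have hξp : 0 ≤ ξ ^ (2*μ) := by rw [ev]; positivity
  have hηp : 0 ≤ η ^ (2*μ) := by rw [ev]; positivity
  rcases le_total |ξ| ρ with h | h
  · refine (hnear ξ η h hη1).trans (Real.exp_le_exp.2 ?_)
    have := mul_le_mul_of_nonneg_right (min_le_left (β/4) c') hξp
    linarith
  · have h2 := h1 (y := η) (by rw [dist_zero_right, Real.norm_eq_abs]; exact hη2) ξ ⟨hξ, h⟩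
    have h3 : ‖f ((ξ:ℂ) + I * η)‖ = ‖f ((ξ:ℂ) + I * η)‖ * Real.exp (-(α * η)) * Real.exp (α * η) := by
      rw [mul_assoc, ← Real.exp_add]; simp
    rw [h3]
    calc _ ≤ Real.exp (-(c' * Real.pi ^ (2*μ))) * Real.exp (α * η) := by
          gcongr; exact h2.le.trans hqc
      _ = Real.exp (-(c' * Real.pi ^ (2*μ)) + α * η) := by rw [Real.exp_add]
      _ ≤ _ := by
        apply Real.exp_le_exp.2
        have h5 : ξ ^ (2*μ) ≤ Real.pi ^ (2*μ) := by
          rw [ev ξ]; exact pow_le_pow_left₀ (abs_nonneg _) hξ _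
        have h6 := mul_le_mul_of_nonneg_right (min_le_right (β/4) c') hξp
        have h7 := mul_le_mul_of_nonneg_left h5 hc'.le
        have h8 := mul_nonneg hC.le hηp
        linarith

lemma tg_opt (μ : ℕ) (hμ : 1 ≤ μ) (n C ε d : ℝ) (hn : 0 < n) (hε : 0 < ε)
    (hε1 : ε ≤ 1) (hεC : C * ε ≤ 1/2) (hC : 0 < C) (y : ℝ) (hy : y = (|d| / n) ^ (1 / (2*(μ:ℝ) - 1))) :
    ∃ η : ℝ, |η| = ε * y ∧ -d * η + n * (C * η ^ (2*μ)) ≤ -(1 / (2/ε)) *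
      (|d| / n ^ ((1 : ℝ) / (2 * (μ : ℝ)))) ^ ((2 * (μ : ℝ)) / (2 * (μ : ℝ) - 1)) := by
  have hμr : (1:ℝ) ≤ μ := by exact_mod_cast hμ
  obtain ⟨k, hk⟩ : ∃ k, 2 * μ = k + 1 := ⟨2*μ-1, by omega⟩
  have hk1 : 1 ≤ k := by omega
  have hkr : 2 * (μ:ℝ) = (k:ℝ) + 1 := by exact_mod_cast hk
  have hk0 : (k:ℝ) ≠ 0 := by positivity
  have hx0 : 0 ≤ |d| / n := by positivity
  have hy0 : 0 ≤ y := by rw [hy]; positivity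
  have hyk : y ^ k = |d| / n := by
    rw [hy, hkr, add_sub_cancel_right, one_div, Real.rpow_inv_natCast_pow hx0 (by omega)]
  set s : ℝ := n ^ ((1 : ℝ) / (2 * (μ : ℝ))) with hs
  have hs0 : 0 < s := by positivity
  have hsk : s ^ (k+1) = n := by
    rw [hs, ← hk, one_div]
    have : (2 * (μ:ℝ)) = ((2*μ : ℕ):ℝ) := by push_cast; ring
    rw [this, Real.rpow_inv_natCast_pow hn.le (by omega)]
  have hdk : |d| / s = (s * y) ^ k := by
    rw [mul_pow, hyk]
    have : s ^ k * s = n := by rw [← pow_succ, hsk]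
    rw [← this]
    field_simp
  have hT : (|d| / s) ^ ((2 * (μ : ℝ)) / (2 * (μ : ℝ) - 1)) = n * y ^ (k+1) := by
    rw [hdk, hkr, add_sub_cancel_right, ← Real.rpow_natCast, ← Real.rpow_mul (by positivity),
      mul_div_cancel₀ _ hk0, ← hsk, ← mul_pow]
    exact_mod_cast Real.rpow_natCast (s*y) (k+1)
  rw [hT]
  obtain ⟨σ, hσ, hσd⟩ : ∃ σ : ℝ, |σ| = 1 ∧ d * σ = |d| := by
    rcases le_total 0 d with h | h
    · exact ⟨1, by simp, by rw [abs_of_nonneg h]; ring⟩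
    · exact ⟨-1, by simp, by rw [abs_of_nonpos h]; ring⟩
  refine ⟨σ * (ε * y), by rw [abs_mul, hσ, abs_of_nonneg (by positivity)]; ring, ?_⟩
  have e1 : (σ * (ε * y)) ^ (2*μ) = ε ^ (k+1) * y ^ (k+1) := by
    rw [← Even.pow_abs (even_two_mul μ), abs_mul, hσ, one_mul, abs_of_nonneg (by positivity),
      hk, mul_pow]
  have e2 : -d * (σ * (ε * y)) = - (ε * (n * y ^ (k+1))) := by
    have : |d| = n * y ^ k := by rw [hyk]; field_simp
    calc -d * (σ * (ε * y)) = -((d * σ) * (ε * y)) := by ring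
      _ = _ := by rw [hσd, this]; ring
  rw [e1, e2]
  have hz : 0 ≤ n * y ^ (k+1) := by positivity
  have e3 : C * ε ^ (k+1) ≤ ε / 2 := by
    have : ε ^ (k+1) ≤ ε ^ 2 := pow_le_pow_of_le_one hε.le hε1 (by omega)
    have := mul_le_mul_of_nonneg_left this hC.le
    nlinarith
  have e4 := mul_le_mul_of_nonneg_right e3 hz
  have e5 : 1 / (2/ε) = ε/2 := by field_simp
  rw [e5]
  nlinarith

/-- Lemma 9: in the explicit case with `K = 1` and `α > 0`, setting `δ = α/2`, the temporal
Green's function satisfies the generalized gaussian bound in the range `nδ ≤ j ≤ nr`. -/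
theorem temporal_green_gaussian_bound
    (r p : ℕ) (hrp : 1 ≤ p + r) (a0 a1 : ℤ → ℂ)
    (α β : ℝ) (μ : ℕ) (hα : 0 < α) (hβ : 0 < β) (hμ : 1 ≤ μ)
    (L : Seq2 →L[ℂ] Seq2)
    -- Assumption 1
    (hQ1_ne : ∀ κ : ℂ, ‖κ‖ = 1 → symbol r p a1 κ ≠ 0)
    (hQ1_index : (2 * (Real.pi : ℂ) * Complex.I)⁻¹ *
      (∮ κ in C(0, 1), deriv (symbol r p a1) κ / symbol r p a1 κ) = 0)
    -- `ℒ = Q₁⁻¹ Q₀` is characterized by `Q₁ ∘ ℒ = Q₀`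
    (hL : ∀ (u : Seq2) (j : ℤ),
      convAct r p a1 (fun i => L u i) j = convAct r p a0 (fun i => u i) j)
    -- explicit case: `Q₁ = I`
    (hQ1id : ∀ ℓ ∈ Finset.Icc (-(r : ℤ)) (p : ℤ), a1 ℓ = if ℓ = 0 then 1 else 0)
    -- Assumption 2 specialized to `K = 1`, `κ̲₁ = 1`, `z̲₁ = F(1) = 1`
    (hF1 : Fsym r p a0 a1 1 = 1)
    (hFlt : ∀ κ : ℂ, ‖κ‖ = 1 → κ ≠ 1 → ‖Fsym r p a0 a1 κ‖ < 1)
    (hexp : ∃ g : ℝ → ℂ, (g =O[nhds 0] fun ξ : ℝ => ξ ^ (2 * μ + 1)) ∧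
      ∀ᶠ ξ : ℝ in nhds 0, Fsym r p a0 a1 (Complex.exp (Complex.I * ξ)) =
        Complex.exp (-(Complex.I) * (α : ℂ) * (ξ : ℂ)
          - (β : ℂ) * (ξ : ℂ) ^ (2 * μ) + g ξ))
    -- Assumption 3
    (hA : ∀ z : ℂ, 1 ≤ ‖z‖ → Acoef a0 a1 (-(r : ℤ)) z ≠ 0 ∧ Acoef a0 a1 (p : ℤ) z ≠ 0)
    : ∃ C > (0 : ℝ), ∃ M > (0 : ℝ), ∀ n : ℕ, 1 ≤ n → ∀ j : ℤ,
      (n : ℝ) * (α / 2) ≤ (j : ℝ) → (j : ℝ) ≤ (n : ℝ) * (r : ℝ) →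
      ‖((L ^ n) dirac) j‖ ≤
        C / (n : ℝ) ^ ((1 : ℝ) / (2 * (μ : ℝ))) *
          Real.exp (-(1 / M) * (|(j : ℝ) - α * (n : ℝ)| /
              (n : ℝ) ^ ((1 : ℝ) / (2 * (μ : ℝ)))) ^
            ((2 * (μ : ℝ)) / (2 * (μ : ℝ) - 1))) := by
  have hsym1 : ∀ κ, symbol r p a1 κ = 1 := by
    intro κ
    unfold symbol
    rw [Finset.sum_eq_single (0:ℤ)]
    · rw [hQ1id 0 (by simp)]; simp
    · intro l hl hl0
      rw [hQ1id l hl, if_neg hl0, zero_mul]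
    · intro h; exact absurd (by simp) h
  have hconv1 : ∀ (u : ℤ → ℂ) j, convAct r p a1 u j = u j := by
    intro u j
    unfold convAct
    rw [Finset.sum_eq_single (0:ℤ)]
    · rw [hQ1id 0 (by simp)]; simp
    · intro l hl hl0
      rw [hQ1id l hl, if_neg hl0, zero_mul]
    · intro h; exact absurd (by simp) h
  have hFs : ∀ κ, Fsym r p a0 a1 κ = symbol r p a0 κ := by
    intro κ; rw [Fsym, hsym1, div_one]
  simp_rw [hFs] at hF1 hFlt hexp
  set f : ℂ → ℂ := fun w => symbol r p a0 (exp (I * w)) with hf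
  have hfd : Differentiable ℂ f := by
    have : f = fun w => ∑ l ∈ Finset.Icc (-(r : ℤ)) (p : ℤ), a0 l * exp (l * (I * w)) := by
      funext w
      simp only [hf, symbol]
      refine Finset.sum_congr rfl fun l _ => ?_
      rw [Complex.exp_int_mul]
    rw [this]
    fun_prop
  have hlt : ∀ ξ : ℝ, |ξ| ≤ Real.pi → ξ ≠ 0 → ‖f ξ‖ < 1 := by
    intro ξ h1 h2
    apply hFlt
    · rw [mul_comm]; exact Complex.norm_exp_ofReal_mul_I ξ
    · intro h
      rw [Complex.exp_eq_one_iff] at h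
      obtain ⟨m, hm⟩ := h
      have h3 : (ξ:ℂ) = ((m * (2 * Real.pi) : ℝ) : ℂ) := by
        apply mul_left_cancel₀ I_ne_zero
        rw [hm]; push_cast; ring
      have h4 : ξ = m * (2 * Real.pi) := by exact_mod_cast h3
      have hm0 : m ≠ 0 := by
        rintro rfl
        apply h2; rw [h4]; simp
      have h5 : (1:ℝ) ≤ |(m:ℝ)| := by exact_mod_cast Int.one_le_abs hm0
      have hpi := Real.pi_pos
      rw [h4, abs_mul, abs_of_pos (by positivity : 0 < 2 * Real.pi)] at h1
      nlinarith
  obtain ⟨c, hc, C, hC, ρ, hρ, hkey⟩ := tg_key f hfd α β hβ μ hlt hexp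
  obtain ⟨K, hK, hIbd⟩ := tg_int μ hμ c hc
  set Y : ℝ := ((r:ℝ) + α) ^ (1 / (2*(μ:ℝ) - 1)) with hY
  have hμr : (1:ℝ) ≤ μ := by exact_mod_cast hμ
  have hY0 : 0 ≤ Y := by positivity
  set ε : ℝ := min 1 (min (1/(2*C)) (ρ/(Y+1))) with hεdef
  have hε : 0 < ε := by positivity
  have hε1 : ε ≤ 1 := min_le_left _ _
  have hε2 : ε ≤ 1/(2*C) := (min_le_right _ _).trans (min_le_left _ _)
  have hε3 : ε ≤ ρ/(Y+1) := (min_le_right _ _).trans (min_le_right _ _)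
  have hεC : C * ε ≤ 1/2 := by
    have := mul_le_mul_of_nonneg_left hε2 hC.le
    have e : C * (1/(2*C)) = 1/2 := by field_simp
    linarith
  refine ⟨K, hK, 2/ε, by positivity, ?_⟩
  intro n hn j hj1 hj2
  have hnr : (0:ℝ) < n := by exact_mod_cast hn
  obtain ⟨η, hη, hopt⟩ := tg_opt μ hμ n C ε ((j:ℝ) - α * n) hnr hε hε1 hεC hC _ rfl
  have hηρ : |η| ≤ ρ := by
    rw [hη]
    have h1 : (|(j:ℝ) - α * n| / n) ^ (1 / (2*(μ:ℝ) - 1)) ≤ Y := by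
      apply Real.rpow_le_rpow (by positivity)
      · rw [div_le_iff₀ hnr, abs_le]
        have hjp : 0 ≤ (j:ℝ) := le_trans (by positivity) hj1
        have : 0 ≤ α * n := by positivity
        have : 0 ≤ (r:ℝ) * n := by positivity
        constructor <;> nlinarith
      · apply div_nonneg zero_le_one; linarith
    calc _ ≤ ρ/(Y+1) * Y := by gcongr
      _ ≤ ρ/(Y+1) * (Y+1) := by gcongr; linarith
      _ = ρ := by field_simp
  set G : ℕ → ℤ → ℂ := fun n j => ((L ^ n) dirac) j with hG
  have hG0 : ∀ j, G 0 j = if j = 0 then 1 else 0 := by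
    intro j
    simp only [hG, pow_zero, one_apply_eq_self, dirac]
    rw [lp.single_apply]
    by_cases h : j = 0
    · subst h; simp
    · simp [h]
  have hGs : ∀ n j, G (n+1) j = convAct r p a0 (G n) j := by
    intro n j
    have := hL ((L ^ n) dirac) j
    rw [hconv1] at this
    simp only [hG, pow_succ']
    exact this
  have hgr := tg_green r p a0 G hG0 hGs η n j
  set s : ℝ := (n:ℝ) ^ ((1 : ℝ) / (2 * (μ : ℝ))) with hs
  have hs0 : 0 < s := by positivity
  have hsk : s ^ (2*μ) = n := by
    rw [hs, one_div]
    have : (2 * (μ:ℝ)) = ((2*μ : ℕ):ℝ) := by push_cast; ring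
    rw [this, Real.rpow_inv_natCast_pow hnr.le (by omega)]
  set D : ℝ := -((j:ℝ) - α * n) * η + n * (C * η ^ (2*μ)) with hD
  have hpi := Real.pi_pos
  have hbound : ‖∫ ξ in (-Real.pi)..Real.pi,
      symbol r p a0 (exp (I * ((ξ:ℂ) + I * η))) ^ n * exp (I * ((ξ:ℂ) + I * η)) ^ j‖ ≤
      ∫ ξ in (-Real.pi)..Real.pi, Real.exp D * Real.exp (-c * (s * ξ) ^ (2*μ)) := by
    apply intervalIntegral.norm_integral_le_of_norm_le (by linarith)
    · refine Eventually.of_forall fun ξ hξ => ?_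
      have h1 := hkey ξ η (abs_le.2 ⟨hξ.1.le, hξ.2⟩) hηρ
      have h2 : ‖exp (I * ((ξ:ℂ) + I * η))‖ = Real.exp (-η) := by
        rw [Complex.norm_exp]; simp
      have hzp : Real.exp (-η) ^ j = Real.exp (j * -η) := by
        rw [← Real.rpow_intCast, ← Real.exp_mul, mul_comm]
      rw [norm_mul, norm_pow, norm_zpow, h2, hzp]
      calc _ ≤ (Real.exp (α * η - c * ξ ^ (2*μ) + C * η ^ (2*μ))) ^ n * Real.exp (j * -η) := by
            gcongr
        _ = Real.exp (n * (α * η - c * ξ ^ (2*μ) + C * η ^ (2*μ)) + j * -η) := by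
            rw [← Real.exp_nat_mul, Real.exp_add]
        _ = Real.exp (D + -c * (s * ξ) ^ (2*μ)) := by
            congr 1
            rw [mul_pow, hsk, hD]; ring
        _ = _ := Real.exp_add _ _
    · exact Continuous.intervalIntegrable (by fun_prop) _ _
  rw [← hgr, intervalIntegral.integral_const_mul, norm_mul] at hbound
  have h2pi : ‖(2:ℂ) * Real.pi‖ = 2 * Real.pi := by
    rw [norm_mul, Complex.norm_real, Real.norm_of_nonneg hpi.le]; simp
  rw [h2pi] at hbound
  have hone : 1 ≤ 2 * Real.pi := by linarith [Real.pi_gt_three]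
  change ‖G n j‖ ≤ _
  calc ‖G n j‖ ≤ 2 * Real.pi * ‖G n j‖ := le_mul_of_one_le_left (norm_nonneg _) hone
    _ ≤ Real.exp D * (K / s) := hbound.trans (mul_le_mul_of_nonneg_left (hIbd s hs0) (Real.exp_pos _).le)
    _ = K / s * Real.exp D := mul_comm _ _
    _ ≤ _ := by
      apply mul_le_mul_of_nonneg_left (Real.exp_le_exp.2 hopt) (by positivity)
end
end

section
/- Under Assumptions 1–5 in the explicit case with pairwise distinct ordered drifts α₁ < … < α_K and sectors 𝒟_k, 𝒟_* as defined, there exist constants C > 0 and δ_* > 0 such that for every pair (j, n) ∈ 𝒟_*, the temporal Green's function satisfies |𝒢ⁿ_j| ≤ C exp(−n δ_*). -/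
open scoped Classical
open Complex Filter Asymptotics Metric

noncomputable section

set_option autoImplicit false

/-- The full set of data and assumptions (Assumptions 1–5) of the paper. -/
structure Setup where
  r : ℕ
  p : ℕ
  hrp : 1 ≤ p + r
  a0 : ℤ → ℂ
  a1 : ℤ → ℂ
  K : ℕ
  hK : 1 ≤ K
  /-- the tangency points `κ̲₁, …, κ̲_K` on the unit circle -/
  kap : Fin K → ℂ
  /-- the drifts `α_k` -/
  α : Fin K → ℝ
  /-- the diffusion coefficients `β_k` -/
  β : Fin K → ℝ
  /-- the integers `μ_k` (the order of tangency is `2 μ_k`) -/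
  μ : Fin K → ℕ
  /-- the operator `ℒ = Q₁⁻¹ Q₀` acting on `ℓ²(ℤ;ℂ)` -/
  L : Seq2 →L[ℂ] Seq2
  /-- Assumption 1: the symbol of `Q₁` does not vanish on the unit circle -/
  hQ1_ne : ∀ κ : ℂ, ‖κ‖ = 1 → symbol r p a1 κ ≠ 0
  /-- Assumption 1: the index condition -/
  hQ1_index :
    (2 * (Real.pi : ℂ) * Complex.I)⁻¹ *
      (∮ κ in C(0, 1), deriv (symbol r p a1) κ / symbol r p a1 κ) = 0
  /-- `ℒ` is characterized by `Q₁ ∘ ℒ = Q₀` -/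
  hL : ∀ (u : Seq2) (j : ℤ),
    convAct r p a1 (fun i => L u i) j = convAct r p a0 (fun i => u i) j
  /-- Assumption 2: the `κ̲_k` are distinct points of the unit circle -/
  hkap_unit : ∀ k, ‖kap k‖ = 1
  hkap_inj : Function.Injective kap
  /-- Assumption 2: `|F| < 1` away from the `κ̲_k` -/
  hF_lt : ∀ κ : ℂ, ‖κ‖ = 1 → (∀ k, κ ≠ kap k) → ‖Fsym r p a0 a1 κ‖ < 1
  /-- Assumption 2: `F(κ̲_k) ∈ 𝕊¹` -/
  hF_unit : ∀ k, ‖Fsym r p a0 a1 (kap k)‖ = 1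
  hα : ∀ k, α k ≠ 0
  hβ : ∀ k, 0 < β k
  hμ : ∀ k, 1 ≤ μ k
  /-- Assumption 2: local expansion
  `F(κ̲_k e^{iξ})/F(κ̲_k) = exp(-i α_k ξ - β_k ξ^{2μ_k} + O(ξ^{2μ_k+1}))` as `ξ → 0` -/
  hexp : ∀ k, ∃ g : ℝ → ℂ,
    (g =O[nhds 0] fun ξ : ℝ => ξ ^ (2 * μ k + 1)) ∧
    ∀ᶠ ξ : ℝ in nhds 0,
      Fsym r p a0 a1 (kap k * Complex.exp (Complex.I * ξ)) / Fsym r p a0 a1 (kap k)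
        = Complex.exp (-(Complex.I) * (α k : ℂ) * (ξ : ℂ)
            - (β k : ℂ) * (ξ : ℂ) ^ (2 * μ k) + g ξ)
  /-- Assumption 3: `𝔸_{-r}` and `𝔸_p` do not vanish on `𝒰̄` -/
  hA : ∀ z : ℂ, 1 ≤ ‖z‖ → Acoef a0 a1 (-(r : ℤ)) z ≠ 0 ∧ Acoef a0 a1 (p : ℤ) z ≠ 0
  /-- Assumption 4: either `Q₁` is the identity, or `a_{-r,1} ≠ 0` and `a_{p,1} ≠ 0` -/
  hQ1' : (∀ ℓ ∈ Finset.Icc (-(r : ℤ)) (p : ℤ), a1 ℓ = if ℓ = 0 then 1 else 0) ∨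
    (a1 (-(r : ℤ)) ≠ 0 ∧ a1 (p : ℤ) ≠ 0)
  /-- Assumption 5: each `ℐ_k` has one or two elements -/
  h5card : ∀ k : Fin K,
    (Finset.univ.filter fun ν =>
      Fsym r p a0 a1 (kap ν) = Fsym r p a0 a1 (kap k)).card ≤ 2
  /-- Assumption 5: when `ℐ_k` has two elements, the corresponding drifts have opposite signs -/
  h5sign : ∀ k ν₁ ν₂ : Fin K,
    Fsym r p a0 a1 (kap ν₁) = Fsym r p a0 a1 (kap k) →
    Fsym r p a0 a1 (kap ν₂) = Fsym r p a0 a1 (kap k) →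
    ν₁ ≠ ν₂ → α ν₁ * α ν₂ < 0

/-- the symbol `F` of `ℒ` -/
def Setup.F (S : Setup) : ℂ → ℂ := Fsym S.r S.p S.a0 S.a1

/-- the tangency points `z̲_k = F(κ̲_k)` of the spectrum of `ℒ` with the unit circle -/
def Setup.zK (S : Setup) (k : Fin S.K) : ℂ := S.F (S.kap k)

/-- the matrix `𝕄(z)` -/
def Setup.M (S : Setup) (z : ℂ) : Matrix (Fin (S.p + S.r)) (Fin (S.p + S.r)) ℂ :=
  Mmat S.r S.p S.a0 S.a1 z


/-- the symbol on the complexified circle -/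
def Hs (S : Setup) (w : ℂ) : ℂ :=
  ∑ ℓ ∈ Finset.Icc (-(S.r : ℤ)) (S.p : ℤ), S.a0 ℓ * Complex.exp (Complex.I * ℓ * w)

lemma Hs_contDiff (S : Setup) : ContDiff ℂ 1 (Hs S) := by
  unfold Hs
  fun_prop

lemma zero_mem_Icc (S : Setup) : (0 : ℤ) ∈ Finset.Icc (-(S.r : ℤ)) (S.p : ℤ) := by
  simp

lemma symbol_a1 (S : Setup)
    (hQ : ∀ ℓ ∈ Finset.Icc (-(S.r : ℤ)) (S.p : ℤ), S.a1 ℓ = if ℓ = 0 then 1 else 0) (κ : ℂ) :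
    symbol S.r S.p S.a1 κ = 1 := by
  unfold symbol
  rw [Finset.sum_eq_single_of_mem 0 (zero_mem_Icc S)]
  · rw [hQ 0 (zero_mem_Icc S)]; simp
  · intro b hb hb0
    rw [hQ b hb]; simp [hb0]

lemma Fsym_exp (S : Setup)
    (hQ : ∀ ℓ ∈ Finset.Icc (-(S.r : ℤ)) (S.p : ℤ), S.a1 ℓ = if ℓ = 0 then 1 else 0) (w : ℂ) :
    Fsym S.r S.p S.a0 S.a1 (Complex.exp (Complex.I * w)) = Hs S w := by
  unfold Fsym Hs
  rw [symbol_a1 S hQ, div_one, symbol]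
  refine Finset.sum_congr rfl fun ℓ _ => ?_
  rw [← Complex.exp_int_mul]
  congr 2; ring

lemma Lop_apply (S : Setup)
    (hQ : ∀ ℓ ∈ Finset.Icc (-(S.r : ℤ)) (S.p : ℤ), S.a1 ℓ = if ℓ = 0 then 1 else 0)
    (u : Seq2) (j : ℤ) :
    S.L u j = ∑ ℓ ∈ Finset.Icc (-(S.r : ℤ)) (S.p : ℤ), S.a0 ℓ * u (j + ℓ) := by
  have h := S.hL u j
  unfold convAct at h
  rw [← h, Finset.sum_eq_single_of_mem 0 (zero_mem_Icc S)]
  · rw [hQ 0 (zero_mem_Icc S)]; simp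
  · intro b hb hb0
    rw [hQ b hb]; simp [hb0]

lemma exists_primitive (S : Setup)
    (hQ : ∀ ℓ ∈ Finset.Icc (-(S.r : ℤ)) (S.p : ℤ), S.a1 ℓ = if ℓ = 0 then 1 else 0) (n : ℕ) :
    ∀ j : ℤ, ∃ Φ : ℂ → ℂ,
      (∀ w, HasDerivAt Φ (Hs S w ^ n * Complex.exp (Complex.I * j * w)) w) ∧
      ∀ w, Φ (w + 2 * Real.pi) - Φ w = 2 * Real.pi * ((S.L ^ n) dirac) j := by
  induction n with
  | zero =>
    intro j
    by_cases hj : j = 0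
    · subst hj
      refine ⟨fun w => w, fun w => ?_, fun w => ?_⟩
      · exact (hasDerivAt_id w).congr_deriv (by simp)
      · simp [dirac]
    · have hjc : Complex.I * (j : ℂ) ≠ 0 := by simp [hj]
      refine ⟨fun w => Complex.exp (Complex.I * j * w) / (Complex.I * j), fun w => ?_, fun w => ?_⟩
      · have h1 : HasDerivAt (fun w : ℂ => Complex.I * j * w) (Complex.I * j) w := by
          simpa using (hasDerivAt_id w).const_mul (Complex.I * (j : ℂ))
        have h2 := (h1.cexp).div_const (Complex.I * (j : ℂ))
        refine h2.congr_deriv ?_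
        rw [pow_zero, one_mul, mul_div_assoc, div_self hjc, mul_one]
      · have : Complex.exp (Complex.I * j * (w + 2 * Real.pi)) = Complex.exp (Complex.I * j * w) := by
          rw [Complex.exp_eq_exp_iff_exists_int]
          exact ⟨j, by ring⟩
        simp only [this]
        simp [dirac, lp.single_apply, Pi.single_apply, hj]
  | succ n ih =>
    intro j
    choose Φ h1 h2 using ih
    refine ⟨fun w => ∑ ℓ ∈ Finset.Icc (-(S.r : ℤ)) (S.p : ℤ), S.a0 ℓ * Φ (j + ℓ) w,
      fun w => ?_, fun w => ?_⟩
    · have h := HasDerivAt.fun_sum (u := Finset.Icc (-(S.r : ℤ)) (S.p : ℤ))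
        (fun ℓ _ => (h1 (j + ℓ) w).const_mul (S.a0 ℓ))
      refine h.congr_deriv (Eq.symm ?_)
      rw [pow_succ, mul_assoc, mul_comm (Hs S w), ← mul_assoc]
      have hH : Hs S w = ∑ ℓ ∈ Finset.Icc (-(S.r : ℤ)) (S.p : ℤ),
          S.a0 ℓ * Complex.exp (Complex.I * ℓ * w) := rfl
      conv_lhs => enter [2]; rw [hH]
      rw [Finset.mul_sum]
      refine Finset.sum_congr rfl fun ℓ _ => ?_
      have : Complex.exp (Complex.I * ((j + ℓ : ℤ) : ℂ) * w)
          = Complex.exp (Complex.I * j * w) * Complex.exp (Complex.I * ℓ * w) := by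
        rw [← Complex.exp_add]; congr 1; push_cast; ring
      rw [this]
      ring
    · rw [pow_succ']
      change _ = 2 * Real.pi * (S.L ((S.L ^ n) dirac)) j
      rw [Lop_apply S hQ, ← Finset.sum_sub_distrib, Finset.mul_sum]
      refine Finset.sum_congr rfl fun ℓ _ => ?_
      rw [← mul_sub, h2]; ring

lemma Hs_deriv (S : Setup)
    (hQ : ∀ ℓ ∈ Finset.Icc (-(S.r : ℤ)) (S.p : ℤ), S.a1 ℓ = if ℓ = 0 then 1 else 0)
    (k : Fin S.K) (u : ℝ) (hu : Complex.exp (Complex.I * u) = S.kap k) :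
    HasStrictDerivAt (Hs S) (-Complex.I * S.α k * Hs S u) u := by
  have hs : HasStrictDerivAt (Hs S) (deriv (Hs S) u) u :=
    (Hs_contDiff S).contDiffAt.hasStrictDerivAt (by norm_num)
  obtain ⟨g, hg, hev⟩ := S.hexp k
  have hne : Hs S u ≠ 0 := by
    rw [← Fsym_exp S hQ, hu]
    intro h0
    have := S.hF_unit k
    rw [h0] at this; simp at this
  -- real derivative, first way
  have e1 : HasDerivAt (fun ξ : ℝ => Hs S (u + ξ)) (deriv (Hs S) u) 0 := by
    have h := hs.hasDerivAt
    have h' : HasDerivAt (fun w : ℂ => Hs S (u + w)) (deriv (Hs S) u) ((0 : ℝ) : ℂ) := by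
      have h'' : HasDerivAt (Hs S) (deriv (Hs S) u) ((u : ℂ) + ((0 : ℝ) : ℂ)) := by simpa using h
      simpa using h''.comp_const_add (u : ℂ) _
    exact h'.comp_ofReal
  have g0 : g 0 = 0 := by
    have := hg.eq_zero_imp.self_of_nhds
    exact this (by simp)
  have hgd : HasDerivAt g 0 0 := by
    rw [hasDerivAt_iff_isLittleO]
    simp only [g0, sub_zero, smul_zero]
    refine hg.trans_isLittleO ?_
    have := isLittleO_pow_pow (𝕜 := ℝ) (m := 1) (n := 2 * S.μ k + 1) (by have := S.hμ k; omega)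
    simpa using this
  have e2 : HasDerivAt (fun ξ : ℝ => Hs S u * Complex.exp (-(Complex.I) * (S.α k : ℂ) * (ξ : ℂ)
            - (S.β k : ℂ) * (ξ : ℂ) ^ (2 * S.μ k) + g ξ)) (-Complex.I * S.α k * Hs S u) 0 := by
    have i0 : HasDerivAt (fun ξ : ℝ => (ξ : ℂ)) 1 0 := Complex.ofRealCLM.hasDerivAt
    have i1 := i0.const_mul (-(Complex.I) * (S.α k : ℂ))
    have i2 := (i0.pow (2 * S.μ k)).const_mul (S.β k : ℂ)
    have i3 := (((i1.sub i2).add hgd).cexp).const_mul (Hs S u)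
    have hm : 2 * S.μ k ≠ 0 := by have := S.hμ k; omega
    have hm1 : 2 * S.μ k - 1 ≠ 0 := by have := S.hμ k; omega
    refine i3.congr_deriv ?_
    simp [g0, hm, hm1]
    ring
  have e3 : HasDerivAt (fun ξ : ℝ => Hs S (u + ξ)) (-Complex.I * S.α k * Hs S u) 0 := by
    refine e2.congr_of_eventuallyEq ?_
    filter_upwards [hev] with ξ hξ
    rw [← hξ, ← hu, ← Complex.exp_add, ← mul_add, Fsym_exp S hQ, Fsym_exp S hQ]
    field_simp
  rw [← e1.unique e3]
  exact hs

lemma Hs_le_one (S : Setup)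
    (hQ : ∀ ℓ ∈ Finset.Icc (-(S.r : ℤ)) (S.p : ℤ), S.a1 ℓ = if ℓ = 0 then 1 else 0)
    (u : ℝ) : ‖Hs S u‖ ≤ 1 := by
  rw [← Fsym_exp S hQ]
  by_cases h : ∃ k, Complex.exp (Complex.I * u) = S.kap k
  · obtain ⟨k, hk⟩ := h
    rw [hk, S.hF_unit]
  · push Not at h
    refine (S.hF_lt _ ?_ h).le
    rw [mul_comm]; exact Complex.norm_exp_ofReal_mul_I u

/-- the local expansion near a tangency point -/
lemma Hs_littleO (S : Setup)
    (hQ : ∀ ℓ ∈ Finset.Icc (-(S.r : ℤ)) (S.p : ℤ), S.a1 ℓ = if ℓ = 0 then 1 else 0)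
    (k : Fin S.K) (u : ℝ) (hu : Complex.exp (Complex.I * u) = S.kap k) :
    (fun q : ℝ × ℝ => Hs S (q.1 + Complex.I * q.2) - Hs S q.1 * (1 + S.α k * q.2))
      =o[nhds (u, 0)] fun q : ℝ × ℝ => q.2 := by
  have hs := (Hs_deriv S hQ k u hu).isLittleO
  have ht : Tendsto (fun q : ℝ × ℝ => ((q.1 : ℂ) + Complex.I * q.2, (q.1 : ℂ))) (nhds (u, 0))
      (nhds ((u : ℂ), (u : ℂ))) := by
    have : Continuous (fun q : ℝ × ℝ => ((q.1 : ℂ) + Complex.I * q.2, (q.1 : ℂ))) := by fun_prop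
    simpa using this.tendsto (u, 0)
  have h1 := hs.comp_tendsto ht
  have h1' : (fun q : ℝ × ℝ => Hs S (q.1 + Complex.I * q.2) - Hs S q.1
      - (Complex.I * q.2) * (-Complex.I * S.α k * Hs S u)) =o[nhds (u, 0)]
      fun q : ℝ × ℝ => q.2 := by
    refine (h1.congr_left ?_).trans_isBigO ?_
    · intro q; simp
    · refine IsBigO.of_bound 1 (Eventually.of_forall fun q => ?_)
      simp
  have h2 : (fun q : ℝ × ℝ => (S.α k * (Hs S u - Hs S q.1)) * (q.2 : ℂ)) =o[nhds (u, 0)]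
      fun q : ℝ × ℝ => q.2 := by
    have hc : Tendsto (fun q : ℝ × ℝ => (S.α k : ℂ) * (Hs S u - Hs S q.1)) (nhds (u, 0))
        (nhds 0) := by
      have : Continuous (fun q : ℝ × ℝ => (S.α k : ℂ) * (Hs S u - Hs S q.1)) := by
        have := (Hs_contDiff S).continuous
        fun_prop
      simpa using this.tendsto (u, 0)
    have h3 := ((isLittleO_one_iff ℂ).2 hc).mul_isBigO
      (isBigO_refl (fun q : ℝ × ℝ => (q.2 : ℂ)) (nhds (u, 0)))
    refine h3.trans_isBigO (IsBigO.of_bound 1 (Eventually.of_forall fun q => ?_))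
    simp
  refine (h1'.add h2).congr_left fun q => ?_
  linear_combination ((q.2 : ℂ) * S.α k * Hs S u) * Complex.I_mul_I

/-- uniform estimate along the deformed contour -/
lemma contour_est (S : Setup)
    (hQ : ∀ ℓ ∈ Finset.Icc (-(S.r : ℤ)) (S.p : ℤ), S.a1 ℓ = if ℓ = 0 then 1 else 0)
    (s η : Fin S.K → ℝ) (hs : ∀ k, |s k| = 1) (hη : ∀ k, 0 < η k) (B : ℝ)
    (P : ℝ → ℝ) (hP : Continuous P)
    (hPk : ∀ k, ∀ u : ℝ, Complex.exp (Complex.I * u) = S.kap k → P u = s k) :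
    ∃ ε > (0 : ℝ), ∃ ρ < (1 : ℝ), ∀ u ∈ Set.Icc (0 : ℝ) (2 * Real.pi), ∀ x : ℝ, |x| ≤ B →
      (∀ k, 2 * η k ≤ s k * (x - S.α k)) →
      ‖Hs S (u + Complex.I * (ε * P u : ℝ))‖ * Real.exp (- x * (ε * P u)) ≤ ρ := by
  have key : ∃ ε0 > (0 : ℝ), ∀ ε, 0 < ε → ε < ε0 → ∃ ρ < (1 : ℝ),
      ∀ u ∈ Set.Icc (0 : ℝ) (2 * Real.pi), ∀ x : ℝ, |x| ≤ B →
      (∀ k, 2 * η k ≤ s k * (x - S.α k)) →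
      ‖Hs S (u + Complex.I * (ε * P u : ℝ))‖ * Real.exp (- x * (ε * P u)) ≤ ρ := by
    refine (isCompact_Icc (a := (0 : ℝ)) (b := 2 * Real.pi)).induction_on
      (p := fun U => ∃ ε0 > (0 : ℝ), ∀ ε, 0 < ε → ε < ε0 → ∃ ρ < (1 : ℝ),
      ∀ u ∈ U, ∀ x : ℝ, |x| ≤ B →
      (∀ k, 2 * η k ≤ s k * (x - S.α k)) →
      ‖Hs S (u + Complex.I * (ε * P u : ℝ))‖ * Real.exp (- x * (ε * P u)) ≤ ρ) ?_ ?_ ?_ ?_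
    · exact ⟨1, one_pos, fun ε _ _ => ⟨0, one_pos, by simp⟩⟩
    · rintro U V hUV ⟨ε0, h0, h⟩
      refine ⟨ε0, h0, fun ε h1 h2 => ?_⟩
      obtain ⟨ρ, hρ, h⟩ := h ε h1 h2
      exact ⟨ρ, hρ, fun u hu => h u (hUV hu)⟩
    · rintro U V ⟨ε0, h0, h⟩ ⟨ε0', h0', h'⟩
      refine ⟨min ε0 ε0', lt_min h0 h0', fun ε h1 h2 => ?_⟩
      obtain ⟨ρ, hρ, h⟩ := h ε h1 (h2.trans_le (min_le_left _ _))
      obtain ⟨ρ', hρ', h'⟩ := h' ε h1 (h2.trans_le (min_le_right _ _))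
      refine ⟨max ρ ρ', max_lt hρ hρ', fun u hu x hx hk => ?_⟩
      rcases hu with hu | hu
      · exact (h u hu x hx hk).trans (le_max_left _ _)
      · exact (h' u hu x hx hk).trans (le_max_right _ _)
    · intro u0 _
      by_cases hc : ∃ k, Complex.exp (Complex.I * u0) = S.kap k
      · obtain ⟨k, hk⟩ := hc
        have hl := (Hs_littleO S hQ k u0 hk).bound (hη k)
        have ht : Tendsto (fun q : ℝ × ℝ => (q.1, q.2 * P q.1)) (nhds (u0, 0))
            (nhds (u0, 0)) := by
          have : Continuous (fun q : ℝ × ℝ => (q.1, q.2 * P q.1)) := by fun_prop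
          simpa using this.tendsto (u0, 0)
        have hl2 := ht.eventually hl
        have hpos : ∀ᶠ q : ℝ × ℝ in nhds (u0, 0), 0 < 1 + S.α k * (q.2 * P q.1) := by
          have : Continuous (fun q : ℝ × ℝ => 1 + S.α k * (q.2 * P q.1)) := by fun_prop
          exact this.continuousAt.eventually_const_lt (by simp)
        have hsP : ∀ᶠ q : ℝ × ℝ in nhds (u0, 0), 1 / 2 < s k * P q.1 := by
          have : Continuous (fun q : ℝ × ℝ => s k * P q.1) := by fun_prop
          refine this.continuousAt.eventually_const_lt ?_
          have : s k * s k = 1 := by rw [← abs_mul_abs_self, hs]; norm_num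
          simp only [hPk k u0 hk, this]; norm_num
        obtain ⟨d, hd, hball⟩ := Metric.eventually_nhds_iff_ball.1 (hl2.and (hpos.and hsP))
        refine ⟨ball u0 d, mem_nhdsWithin_of_mem_nhds (ball_mem_nhds _ hd), d, hd,
          fun ε hε hεd => ⟨Real.exp (-(η k * (ε / 2))), ?_, ?_⟩⟩
        · rw [Real.exp_lt_one_iff]
          have := hη k
          have : 0 < η k * (ε / 2) := by positivity
          linarith
        · intro u hu x _ hxk
          have hmem : ((u, ε) : ℝ × ℝ) ∈ ball ((u0, 0) : ℝ × ℝ) d := by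
            rw [← ball_prod_same]
            refine ⟨hu, ?_⟩
            simp [abs_of_pos hε, hεd]
          obtain ⟨q1, q2, q3⟩ := hball _ hmem
          simp only at q1 q2 q3
          set v : ℝ := ε * P u with hv
          have hsv : ε / 2 ≤ s k * v := by rw [hv]; nlinarith
          have habs : |v| = s k * v := by
            have : |s k * v| = |v| := by rw [abs_mul, hs, one_mul]
            rw [← this, abs_of_pos]; linarith
          have n1 : ‖Hs S (u + Complex.I * (v : ℝ))‖ ≤ (1 + S.α k * v) + η k * |v| := by
            have e : Hs S (u + Complex.I * (v : ℝ)) = Hs S u * (1 + S.α k * v)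
              + (Hs S (u + Complex.I * (v : ℝ)) - Hs S u * (1 + S.α k * v)) := by ring
            rw [e]
            refine (norm_add_le _ _).trans (add_le_add ?_ (by simpa using q1))
            rw [norm_mul]
            have : ‖(1 + S.α k * v : ℂ)‖ = 1 + S.α k * v := by
              have : (1 + S.α k * v : ℂ) = ((1 + S.α k * v : ℝ) : ℂ) := by push_cast; ring
              rw [this, Complex.norm_real, Real.norm_eq_abs, abs_of_pos q2]
            rw [this]
            exact mul_le_of_le_one_left q2.le (Hs_le_one S hQ u)
          have n2 : ‖Hs S (u + Complex.I * (v : ℝ))‖ ≤ Real.exp (S.α k * v + η k * |v|) := by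
            refine n1.trans ?_
            have := Real.add_one_le_exp (S.α k * v + η k * |v|)
            linarith
          refine (mul_le_mul_of_nonneg_right n2 (Real.exp_pos _).le).trans ?_
          rw [← Real.exp_add, Real.exp_le_exp]
          have h2 := hxk k
          have hss : s k * s k = 1 := by rw [← abs_mul_abs_self, hs]; norm_num
          have h3 : 2 * η k * |v| ≤ (x - S.α k) * v := by
            have := mul_le_mul_of_nonneg_right h2 (abs_nonneg v)
            calc _ ≤ _ := this
              _ = (s k * s k) * ((x - S.α k) * v) := by rw [habs]; ring
              _ = _ := by rw [hss, one_mul]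
          have h4 : η k * (ε / 2) ≤ η k * |v| :=
            mul_le_mul_of_nonneg_left (by rw [habs]; exact hsv) (hη k).le
          linarith
      · push Not at hc
        have hlt : ‖Hs S u0‖ < 1 := by
          rw [← Fsym_exp S hQ]
          refine S.hF_lt _ ?_ hc
          rw [mul_comm]; exact Complex.norm_exp_ofReal_mul_I u0
        obtain ⟨ρ, hρ1, hρ2⟩ := exists_between hlt
        have hcont : Continuous (fun q : ℝ × ℝ =>
            ‖Hs S (q.1 + Complex.I * (q.2 * P q.1 : ℝ))‖ * Real.exp (B * |q.2 * P q.1|)) := by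
          have := (Hs_contDiff S).continuous
          fun_prop
        have hev : ∀ᶠ q : ℝ × ℝ in nhds (u0, 0),
            ‖Hs S (q.1 + Complex.I * (q.2 * P q.1 : ℝ))‖ * Real.exp (B * |q.2 * P q.1|) < ρ :=
          hcont.continuousAt.eventually_lt_const (by simpa using hρ1)
        obtain ⟨d, hd, hball⟩ := Metric.eventually_nhds_iff_ball.1 hev
        refine ⟨ball u0 d, mem_nhdsWithin_of_mem_nhds (ball_mem_nhds _ hd), d, hd,
          fun ε hε hεd => ⟨ρ, hρ2, ?_⟩⟩
        intro u hu x hx _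
        have hmem : ((u, ε) : ℝ × ℝ) ∈ ball ((u0, 0) : ℝ × ℝ) d := by
          rw [← ball_prod_same]
          refine ⟨hu, ?_⟩
          simp [abs_of_pos hε, hεd]
        refine le_trans ?_ (hball _ hmem).le
        refine mul_le_mul_of_nonneg_left ?_ (norm_nonneg _)
        rw [Real.exp_le_exp]
        calc -x * (ε * P u) ≤ |-x * (ε * P u)| := le_abs_self _
          _ = |x| * |ε * P u| := by rw [abs_mul, abs_neg]
          _ ≤ _ := mul_le_mul_of_nonneg_right hx (abs_nonneg _)
  obtain ⟨ε0, h0, h⟩ := key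
  exact ⟨ε0 / 2, by positivity, h (ε0 / 2) (by positivity) (by linarith)⟩

lemma exists_P (S : Setup) (s : Fin S.K → ℝ) :
    ∃ P : ℝ → ℝ, ContDiff ℝ 1 P ∧ P (2 * Real.pi) = P 0 ∧
      ∀ k, ∀ u : ℝ, Complex.exp (Complex.I * u) = S.kap k → P u = s k := by
  set q : Polynomial ℂ := Lagrange.interpolate Finset.univ S.kap (fun k => (s k : ℂ)) with hq
  refine ⟨fun u => (q.eval (Complex.exp (Complex.I * u))).re, ?_, ?_, ?_⟩
  · have h1 : ContDiff ℝ 1 (fun u : ℝ => Complex.exp (Complex.I * u)) := by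
      have : ContDiff ℝ 1 (fun u : ℝ => (u : ℂ)) := Complex.ofRealCLM.contDiff
      fun_prop
    have h2 : ContDiff ℝ 1 (fun z : ℂ => q.eval z) := by
      have : ContDiff ℂ 1 (fun z : ℂ => q.eval z) := by
        simpa using (Polynomial.contDiff_aeval (𝕜 := ℂ) q 1)
      exact this.restrict_scalars ℝ
    exact Complex.reCLM.contDiff.comp (h2.comp h1)
  · have : Complex.exp (Complex.I * (2 * Real.pi : ℝ)) = Complex.exp (Complex.I * (0 : ℝ)) := by
      rw [Complex.exp_eq_exp_iff_exists_int]
      exact ⟨1, by push_cast; ring⟩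
    simp only [this]
  · intro k u hu
    simp only [hu]
    rw [hq, Lagrange.eval_interpolate_at_node _ S.hkap_inj.injOn (Finset.mem_univ k)]
    simp

/-- bound for a fixed pattern of signs -/
lemma pattern_bound (S : Setup)
    (hQ : ∀ ℓ ∈ Finset.Icc (-(S.r : ℤ)) (S.p : ℤ), S.a1 ℓ = if ℓ = 0 then 1 else 0)
    (s η : Fin S.K → ℝ) (hs : ∀ k, |s k| = 1) (hη : ∀ k, 0 < η k) (B : ℝ) :
    ∃ C > (0 : ℝ), ∃ δ > (0 : ℝ), ∀ n : ℕ, 1 ≤ n → ∀ j : ℤ, |(j : ℝ) / n| ≤ B →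
      (∀ k, 2 * η k ≤ s k * ((j : ℝ) / n - S.α k)) →
      ‖((S.L ^ n) dirac) j‖ ≤ C * Real.exp (-(n : ℝ) * δ) := by
  obtain ⟨P, hP1, hP2, hP3⟩ := exists_P S s
  obtain ⟨ε, hε, ρ, hρ, hest⟩ := contour_est S hQ s η hs hη B P hP1.continuous hP3
  obtain ⟨M, hM⟩ := (isCompact_Icc (a := (0 : ℝ)) (b := 2 * Real.pi)).exists_bound_of_continuousOn
    (f := fun u => 1 + Complex.I * (ε * deriv P u : ℝ)) (by
      have := hP1.continuous_deriv (le_refl _)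
      fun_prop)
  set ρ' := max ρ (1 / 2) with hρ'
  have hρ'0 : 0 < ρ' := lt_max_of_lt_right (by norm_num)
  have hρ'1 : ρ' < 1 := max_lt hρ (by norm_num)
  have hM0 : 0 ≤ M := (norm_nonneg _).trans (hM 0 ⟨le_refl _, by positivity⟩)
  refine ⟨M + 1, by positivity, -Real.log ρ', by have := Real.log_neg hρ'0 hρ'1; linarith, ?_⟩
  intro n hn j hB hk
  have hexp : Real.exp (-(n : ℝ) * -Real.log ρ') = ρ' ^ n := by
    rw [neg_mul_neg, Real.exp_nat_mul, Real.exp_log hρ'0]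
  rw [hexp]
  obtain ⟨Φ, hΦ1, hΦ2⟩ := exists_primitive S hQ n j
  have hγ : ∀ u : ℝ, HasDerivAt (fun u : ℝ => (u : ℂ) + Complex.I * (ε * P u : ℝ))
      (1 + Complex.I * (ε * deriv P u : ℝ)) u := by
    intro u
    have i0 : HasDerivAt (fun ξ : ℝ => (ξ : ℂ)) 1 u := Complex.ofRealCLM.hasDerivAt
    have i1 := ((hP1.differentiable (by norm_num) u).hasDerivAt.const_mul ε).ofReal_comp
    exact i0.add (i1.const_mul Complex.I)
  have hψ : ∀ u : ℝ, HasDerivAt (fun u : ℝ => Φ ((u : ℂ) + Complex.I * (ε * P u : ℝ)))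
      (Hs S ((u : ℂ) + Complex.I * (ε * P u : ℝ)) ^ n *
        Complex.exp (Complex.I * j * ((u : ℂ) + Complex.I * (ε * P u : ℝ))) *
        (1 + Complex.I * (ε * deriv P u : ℝ))) u := fun u => (hΦ1 _).comp u (hγ u)
  have hbd : ∀ u ∈ Set.Icc (0 : ℝ) (2 * Real.pi),
      ‖Hs S ((u : ℂ) + Complex.I * (ε * P u : ℝ)) ^ n *
        Complex.exp (Complex.I * j * ((u : ℂ) + Complex.I * (ε * P u : ℝ))) *
        (1 + Complex.I * (ε * deriv P u : ℝ))‖ ≤ ρ' ^ n * M := by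
    intro u hu
    rw [norm_mul]
    refine mul_le_mul ?_ (hM u hu) (norm_nonneg _) (by positivity)
    have hn0 : (n : ℝ) ≠ 0 := by positivity
    have hre : ‖Complex.exp (Complex.I * j * ((u : ℂ) + Complex.I * (ε * P u : ℝ)))‖
        = Real.exp (-((j : ℝ) / n) * (ε * P u)) ^ n := by
      rw [Complex.norm_exp, ← Real.exp_nat_mul]
      congr 1
      simp
      field_simp
    rw [norm_mul, norm_pow, hre, ← mul_pow]
    refine pow_le_pow_left₀ (by positivity) ?_ n
    exact (hest u hu _ hB hk).trans (le_max_left _ _)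
  have hmv := (convex_Icc (0 : ℝ) (2 * Real.pi)).norm_image_sub_le_of_norm_hasDerivWithin_le
    (fun u _ => (hψ u).hasDerivWithinAt) hbd (x := 0) (y := 2 * Real.pi)
    ⟨le_refl _, by positivity⟩ ⟨by positivity, le_refl _⟩
  have hper : ((2 * Real.pi : ℝ) : ℂ) + Complex.I * (ε * P (2 * Real.pi) : ℝ)
      = (((0 : ℝ) : ℂ) + Complex.I * (ε * P 0 : ℝ)) + 2 * Real.pi := by
    rw [hP2]; push_cast; ring
  simp only [hper, hΦ2] at hmv
  have hpi := Real.pi_pos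
  rw [norm_mul] at hmv
  have h2pi : ‖(2 * Real.pi : ℂ)‖ = 2 * Real.pi := by
    simp [abs_of_pos hpi]
  rw [h2pi, sub_zero, Real.norm_eq_abs, abs_of_pos (by positivity : 0 < 2 * Real.pi)] at hmv
  have h5 : ‖((S.L ^ n) dirac) j‖ ≤ ρ' ^ n * M := by
    rw [mul_comm] at hmv
    exact le_of_mul_le_mul_right hmv (by positivity)
  have : 0 < ρ' ^ n := by positivity
  nlinarith

/-- Lemma 11: in the explicit case, with pairwise distinct ordered drifts `α₁ < … < α_K` and
sectors `𝒟_k = {n δ̲_k ≤ j ≤ n δ̄_k}`, the temporal Green's function satisfies a uniform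
exponential bound `|𝒢ⁿ_j| ≤ C e^{-n δ_*}` on the complementary region
`𝒟_* = {-pn ≤ j ≤ rn} \ ∪_k 𝒟_k`. -/
theorem temporal_green_sector_complement_bound (S : Setup)
    (hQ1id : ∀ ℓ ∈ Finset.Icc (-(S.r : ℤ)) (S.p : ℤ), S.a1 ℓ = if ℓ = 0 then 1 else 0)
    (hord : StrictMono S.α)
    (δlo δhi : Fin S.K → ℝ)
    (hlo : ∀ k, δlo k < S.α k) (hhi : ∀ k, S.α k < δhi k)
    (hchain : ∀ (k : Fin S.K) (h : (k : ℕ) + 1 < S.K), δhi k < δlo ⟨(k : ℕ) + 1, h⟩)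
    (hlop : ∀ k, -(S.p : ℝ) < δlo k) (hhir : ∀ k, δhi k < (S.r : ℝ))
    (hsgn : ∀ k, (0 < S.α k → 0 < δlo k) ∧ (S.α k < 0 → δhi k < 0)) :
    ∃ C > (0 : ℝ), ∃ δs > (0 : ℝ), ∀ n : ℕ, 1 ≤ n → ∀ j : ℤ,
      -(S.p : ℝ) * (n : ℝ) ≤ (j : ℝ) → (j : ℝ) ≤ (S.r : ℝ) * (n : ℝ) →
      (∀ k, ¬((n : ℝ) * δlo k ≤ (j : ℝ) ∧ (j : ℝ) ≤ (n : ℝ) * δhi k)) →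
      ‖((S.L ^ n) dirac) j‖ ≤ C * Real.exp (-(n : ℝ) * δs) := by
  obtain ⟨η, hη⟩ : ∃ η : Fin S.K → ℝ, ∀ k, 0 < η k ∧ 2 * η k ≤ S.α k - δlo k ∧
      2 * η k ≤ δhi k - S.α k := by
    refine ⟨fun k => min (S.α k - δlo k) (δhi k - S.α k) / 2, fun k => ⟨?_, ?_, ?_⟩⟩
    · have : 0 < min (S.α k - δlo k) (δhi k - S.α k) :=
        lt_min (sub_pos.2 (hlo k)) (sub_pos.2 (hhi k))
      positivity
    · have := min_le_left (S.α k - δlo k) (δhi k - S.α k)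
      linarith
    · have := min_le_right (S.α k - δlo k) (δhi k - S.α k)
      linarith
  have hpat := fun σ : Fin S.K → Bool =>
    pattern_bound S hQ1id (fun k => if σ k then 1 else -1) η
      (fun k => by by_cases h : σ k <;> simp [h]) (fun k => (hη k).1) (S.p + S.r)
  choose C hC δ hδ hb using hpat
  obtain ⟨σ0, hσ0⟩ := Finite.exists_min δ
  refine ⟨∑ σ, C σ, Finset.sum_pos (fun σ _ => hC σ) Finset.univ_nonempty, δ σ0, hδ σ0, ?_⟩
  intro n hn j hj1 hj2 hout
  have hn0 : (0 : ℝ) < n := by exact_mod_cast hn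
  have hx1 : -(S.p : ℝ) ≤ (j : ℝ) / n := by rwa [le_div_iff₀ hn0]
  have hx2 : (j : ℝ) / n ≤ S.r := by rwa [div_le_iff₀ hn0]
  have hp0 : (0 : ℝ) ≤ S.p := Nat.cast_nonneg _
  have hr0 : (0 : ℝ) ≤ S.r := Nat.cast_nonneg _
  have h := hb (fun k => decide ((n : ℝ) * δhi k < j)) n hn j
    (abs_le.2 ⟨by linarith, by linarith⟩) (by
      intro k
      have hk := hη k
      by_cases hc : (n : ℝ) * δhi k < j
      · have : δhi k < (j : ℝ) / n := by rw [lt_div_iff₀ hn0]; linarith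
        simp only [hc, decide_true, if_true]
        linarith
      · have hlt : (j : ℝ) < n * δlo k := by
          by_contra hcon
          exact hout k ⟨not_lt.1 hcon, not_lt.1 hc⟩
        have : (j : ℝ) / n < δlo k := by rw [div_lt_iff₀ hn0]; linarith
        simp only [hc, decide_false, Bool.false_eq_true, if_false]
        linarith)
  refine h.trans (mul_le_mul ?_ ?_ (Real.exp_pos _).le
    (Finset.sum_nonneg fun σ _ => (hC σ).le))
  · exact Finset.single_le_sum (f := C) (fun σ _ => (hC σ).le) (Finset.mem_univ _)
  · rw [Real.exp_le_exp]
    have := mul_le_mul_of_nonneg_left (hσ0 (fun k => decide ((n : ℝ) * δhi k < j))) hn0.le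
    linarith
end
end

section
/- Under Assumptions 1–5 in the explicit case with pairwise distinct ordered drifts α₁ < … < α_K and sectors 𝒟_k as defined, there exist constants C > 0 and M > 0 such that for every k ∈ {1, …, K} and every pair (j, n) ∈ 𝒟_k, the temporal Green's function satisfies |𝒢ⁿ_j| ≤ (C / n^{1/(2μ_k)}) exp( −(1/M) ( |j − α_k n| / n^{1/(2μ_k)} )^{ 2μ_k/(2μ_k−1) } ). -/
open scoped Classical
open Complex Filter Asymptotics Metric

noncomputable section

set_option autoImplicit false

lemma re_pow_lower (m : ℕ) (hm : Even m) :
    ∃ C > (0:ℝ), ∀ ζ : ℂ, ζ.re ^ m / 2 - C * ζ.im ^ m ≤ (ζ ^ m).re := by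
  have hcont : Continuous (fun w : ℝ => (((1:ℂ) + (w:ℂ) * Complex.I) ^ m).re) := by fun_prop
  have h1 : ∀ᶠ w : ℝ in nhds 0, (1/2:ℝ) < (((1:ℂ) + (w:ℂ) * Complex.I) ^ m).re := by
    apply hcont.continuousAt.eventually_const_lt
    norm_num
  obtain ⟨d, hd, h1⟩ := Metric.eventually_nhds_iff.1 h1
  refine ⟨(1/(d/2)) ^ m + (1/(d/2) + 1) ^ m, by positivity, fun ζ => ?_⟩
  have hre := hm.pow_nonneg ζ.re
  have him := hm.pow_nonneg ζ.im
  have hC : 0 ≤ ((1/(d/2)) ^ m + (1/(d/2) + 1) ^ m) * ζ.im ^ m := by positivity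
  by_cases hc : |ζ.im| ≤ d/2 * |ζ.re| ∧ ζ.re ≠ 0
  · obtain ⟨hc, h0⟩ := hc
    have hw := @h1 (ζ.im / ζ.re) (by
      rw [Real.dist_eq, sub_zero, abs_div, div_lt_iff₀ (abs_pos.2 h0)]
      have := abs_pos.2 h0
      nlinarith)
    have e : ζ ^ m = ((ζ.re ^ m : ℝ) : ℂ) * ((1:ℂ) + ((ζ.im / ζ.re : ℝ):ℂ) * Complex.I) ^ m := by
      push_cast
      rw [← mul_pow]
      congr 1
      have : (ζ.re : ℂ) ≠ 0 := by exact_mod_cast h0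
      field_simp
      exact (Complex.re_add_im ζ).symm
    rw [e, Complex.re_ofReal_mul]
    nlinarith
  · have hc' : |ζ.re| ≤ 1/(d/2) * |ζ.im| := by
      by_cases h0 : ζ.re = 0
      · rw [h0, abs_zero]; positivity
      · have h2 : ¬ |ζ.im| ≤ d/2 * |ζ.re| := fun h => hc ⟨h, h0⟩
        push Not at h2
        rw [one_div, ← div_eq_inv_mul, le_div_iff₀ (by positivity)]
        linarith
    have hn : ‖ζ‖ ≤ (1/(d/2) + 1) * |ζ.im| := by
      have := Complex.norm_le_abs_re_add_abs_im ζ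
      linarith
    have h3 : ‖ζ ^ m‖ ≤ (1/(d/2) + 1) ^ m * ζ.im ^ m := by
      rw [norm_pow, ← hm.pow_abs ζ.im, ← mul_pow]
      gcongr
    have h4 : ζ.re ^ m ≤ (1/(d/2)) ^ m * ζ.im ^ m := by
      rw [← hm.pow_abs ζ.im, ← hm.pow_abs ζ.re, ← mul_pow]
      gcongr
    have h5 := (abs_le.1 (Complex.abs_re_le_norm (ζ ^ m))).1
    nlinarith

lemma analytic_bigO (φ : ℂ → ℂ) (hφ : AnalyticAt ℂ φ 0) (m : ℕ)
    (h : (fun ξ : ℝ => φ ξ) =O[nhds 0] fun ξ : ℝ => ξ ^ (m + 1)) :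
    ∃ C > (0:ℝ), ∃ R > (0:ℝ), ∀ ζ : ℂ, ‖ζ‖ ≤ R → ‖φ ζ‖ ≤ C * ‖ζ‖ ^ (m+1) := by
  have key : φ =O[nhds 0] fun ζ : ℂ => ζ ^ (m+1) := by
    by_cases hz : ∀ᶠ z in nhds 0, φ z = 0
    · exact (Asymptotics.isBigO_zero (fun ζ : ℂ => ζ ^ (m+1)) (nhds (0:ℂ))).congr'
        (hz.mono fun z hz => hz.symm) (Filter.EventuallyEq.refl _ _)
    · obtain ⟨k, g, hg, hg0, hk⟩ := (hφ.exists_eventuallyEq_pow_smul_nonzero_iff).2 hz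
      simp only [sub_zero, smul_eq_mul] at hk
      have hkm : m + 1 ≤ k := by
        by_contra hlt
        push Not at hlt
        have hof : Tendsto (fun ξ : ℝ => (ξ:ℂ)) (nhds 0) (nhds 0) := by
          have := Complex.continuous_ofReal.tendsto 0
          simpa using this
        obtain ⟨C, hC⟩ := h.bound
        have h1 := hof.eventually hk
        -- on punctured nhds, ‖g ξ‖ ≤ C |ξ|
        have h2 : ∀ᶠ ξ : ℝ in nhdsWithin 0 {0}ᶜ, ‖g ξ‖ ≤ C * |ξ| ^ (m + 1 - k) := by
          filter_upwards [nhdsWithin_le_nhds hC, nhdsWithin_le_nhds h1, self_mem_nhdsWithin] with ξ a b c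
          have hc : 0 < |ξ| := abs_pos.2 c
          rw [b, norm_mul, norm_pow, norm_pow, Complex.norm_real, Real.norm_eq_abs] at a
          have e : |ξ| ^ (m+1) = |ξ| ^ k * |ξ| ^ (m + 1 - k) := by
            rw [← pow_add]; congr 1; omega
          rw [e] at a
          have : 0 < |ξ| ^ k := by positivity
          refine le_of_mul_le_mul_left ?_ this
          linarith
        have h3 : Tendsto (fun ξ : ℝ => ‖g ξ‖) (nhdsWithin 0 {0}ᶜ) (nhds ‖g 0‖) :=
          ((hg.continuousAt.tendsto.comp hof).norm).mono_left nhdsWithin_le_nhds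
        have h4 : Tendsto (fun ξ : ℝ => C * |ξ| ^ (m + 1 - k)) (nhdsWithin 0 {0}ᶜ) (nhds 0) := by
          have : Continuous (fun ξ : ℝ => C * |ξ| ^ (m + 1 - k)) := by fun_prop
          have := this.tendsto 0
          rw [abs_zero, zero_pow (by omega), mul_zero] at this
          exact this.mono_left nhdsWithin_le_nhds
        have := le_of_tendsto_of_tendsto h3 h4 h2
        exact hg0 (norm_le_zero_iff.1 this)
      have : (fun z : ℂ => z ^ k * g z) =O[nhds 0] fun ζ : ℂ => ζ ^ (m+1) := by
        have e : (fun z : ℂ => z ^ k * g z) = fun z => z ^ (m+1) * (z ^ (k - (m+1)) * g z) := by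
          funext z
          rw [← mul_assoc, ← pow_add]; congr 2; omega
        rw [e]
        have hb : (fun z : ℂ => (z ^ (k - (m+1)) * g z)) =O[nhds 0] fun _ => (1:ℂ) := by
          apply Filter.Tendsto.isBigO_one
          exact ((continuousAt_id.pow _).mul hg.continuousAt).tendsto
        simpa using (Asymptotics.isBigO_refl (fun z : ℂ => z ^ (m+1)) (nhds 0)).mul hb
      exact this.congr' (hk.mono fun z hz => hz.symm) (Filter.EventuallyEq.refl _ _)
  obtain ⟨C, hC0, hC⟩ := key.exists_pos
  obtain ⟨R, hR, hC⟩ := Metric.eventually_nhds_iff.1 hC.bound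
  refine ⟨C, hC0, R/2, by positivity, fun ζ hζ => ?_⟩
  have := @hC ζ (by rw [dist_zero_right]; linarith)
  rwa [norm_pow] at this

lemma local_bound (f : ℂ → ℂ) (hf : Differentiable ℂ f) (α β : ℝ) (hβ : 0 < β) (m : ℕ)
    (hm : Even m) (c0 : ℂ) (hc0 : ‖c0‖ = 1) (g : ℝ → ℂ)
    (hg : g =O[nhds 0] fun ξ : ℝ => ξ ^ (m + 1))
    (hfg : ∀ᶠ ξ : ℝ in nhds 0, f ξ / c0 = Complex.exp (-(Complex.I) * (α : ℂ) * (ξ : ℂ)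
            - (β : ℂ) * (ξ : ℂ) ^ m + g ξ)) :
    ∃ R > (0:ℝ), ∃ c > (0:ℝ), ∃ A > (0:ℝ), ∀ ζ : ℂ, ‖ζ‖ ≤ R →
      ‖f ζ‖ ≤ Real.exp (α * ζ.im - c * ζ.re ^ m + A * ζ.im ^ m) := by
  have hc00 : c0 ≠ 0 := by intro h; simp [h] at hc0
  set φ : ℂ → ℂ := fun ζ => f ζ / c0 *
    Complex.exp (Complex.I * α * ζ + β * ζ ^ m) - 1 with hφ
  have hφd : Differentiable ℂ φ := by
    have := hf.div_const c0
    fun_prop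
  have hφO : (fun ξ : ℝ => φ ξ) =O[nhds 0] fun ξ : ℝ => ξ ^ (m + 1) := by
    have h1 : (fun ξ : ℝ => φ ξ) =ᶠ[nhds 0] fun ξ => Complex.exp (g ξ) - 1 := by
      filter_upwards [hfg] with ξ h
      simp only [hφ]
      rw [h, ← Complex.exp_add]
      congr 2
      ring
    have hg0 : Tendsto g (nhds 0) (nhds 0) := by
      apply hg.trans_tendsto
      have : Continuous (fun ξ : ℝ => ξ ^ (m+1)) := by fun_prop
      simpa using this.tendsto 0
    have h2 : (fun w : ℂ => Complex.exp w - 1) =O[nhds 0] fun w => w := by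
      have := (Complex.hasDerivAt_exp 0).isBigO_sub
      simpa using this
    exact (h2.comp_tendsto hg0).trans hg |>.congr' h1.symm (Filter.EventuallyEq.refl _ _)
  obtain ⟨C, hC, R, hR, hb⟩ := analytic_bigO φ (hφd.analyticAt 0) m hφO
  obtain ⟨C', hC', hre⟩ := re_pow_lower m hm
  refine ⟨min R (β / (4 * C * 2 ^ m)), by positivity, β/4, by positivity,
    β * C' + β / 4, by positivity, fun ζ hζ => ?_⟩
  have hζR := hζ.trans (min_le_left _ _)
  have hζ2 := hζ.trans (min_le_right _ _)
  have e : f ζ = c0 * Complex.exp (-(Complex.I * α * ζ + β * ζ ^ m)) * (1 + φ ζ) := by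
    simp only [hφ]
    rw [Complex.exp_neg]
    have := Complex.exp_ne_zero (Complex.I * α * ζ + β * ζ ^ m)
    field_simp
    ring
  have h1 : ‖1 + φ ζ‖ ≤ Real.exp (C * ‖ζ‖ ^ (m+1)) := by
    calc ‖1 + φ ζ‖ ≤ 1 + ‖φ ζ‖ := by simpa using norm_add_le (1:ℂ) (φ ζ)
      _ ≤ C * ‖ζ‖ ^ (m+1) + 1 := by linarith [hb ζ hζR]
      _ ≤ _ := Real.add_one_le_exp _
  have h2 : C * ‖ζ‖ ^ (m+1) ≤ β / 4 * (ζ.re ^ m + ζ.im ^ m) := by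
    have h3 : ‖ζ‖ ^ m ≤ 2 ^ m * (ζ.re ^ m + ζ.im ^ m) := by
      have : ‖ζ‖ ≤ 2 * max |ζ.re| |ζ.im| := by
        have := Complex.norm_le_abs_re_add_abs_im ζ
        linarith [le_max_left |ζ.re| |ζ.im|, le_max_right |ζ.re| |ζ.im|]
      calc ‖ζ‖ ^ m ≤ (2 * max |ζ.re| |ζ.im|) ^ m := by gcongr
        _ = 2 ^ m * (max |ζ.re| |ζ.im|) ^ m := mul_pow _ _ _
        _ ≤ _ := by
          gcongr
          have a := hm.pow_nonneg ζ.re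
          have b := hm.pow_nonneg ζ.im
          rcases max_choice |ζ.re| |ζ.im| with h | h <;> rw [h, hm.pow_abs] <;> linarith
    have hpos : 0 ≤ ζ.re ^ m + ζ.im ^ m := add_nonneg (hm.pow_nonneg _) (hm.pow_nonneg _)
    calc C * ‖ζ‖ ^ (m+1) = C * ‖ζ‖ * ‖ζ‖ ^ m := by ring
      _ ≤ C * (β / (4 * C * 2 ^ m)) * (2 ^ m * (ζ.re ^ m + ζ.im ^ m)) := by gcongr
      _ = _ := by field_simp
  have h3 : ‖Complex.exp (-(Complex.I * α * ζ + β * ζ ^ m))‖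
      = Real.exp (α * ζ.im - β * (ζ ^ m).re) := by
    rw [Complex.norm_exp]
    congr 1
    simp [Complex.add_re, Complex.mul_re, Complex.mul_im]
    ring
  rw [e, norm_mul, norm_mul, hc0, one_mul, h3]
  calc _ ≤ Real.exp (α * ζ.im - β * (ζ ^ m).re) * Real.exp (C * ‖ζ‖ ^ (m+1)) := by gcongr
    _ = Real.exp (α * ζ.im - β * (ζ ^ m).re + C * ‖ζ‖ ^ (m+1)) := (Real.exp_add _ _).symm
    _ ≤ _ := by
      apply Real.exp_le_exp.2
      have := mul_le_mul_of_nonneg_left (hre ζ) hβ.le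
      linarith

lemma rpow_aux (m : ℕ) (hm : 2 ≤ m) (t y n : ℝ) (ht : 0 < t) (hy : 0 ≤ y) (hn : 0 < n) :
    y * (t * y / n) ^ ((1:ℝ) / ((m:ℝ) - 1)) =
      t ^ ((1:ℝ) / ((m:ℝ) - 1)) * (y / n ^ ((1:ℝ) / (m:ℝ))) ^ ((m:ℝ) / ((m:ℝ) - 1)) := by
  have hm' : (2:ℝ) ≤ m := by exact_mod_cast hm
  have h1 : (0:ℝ) < (m:ℝ) - 1 := by linarith
  rw [Real.div_rpow hy (by positivity), ← Real.rpow_mul hn.le,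
    show (1:ℝ) / (m:ℝ) * ((m:ℝ) / ((m:ℝ) - 1)) = 1 / ((m:ℝ) - 1) by field_simp,
    show (m:ℝ) / ((m:ℝ) - 1) = 1 + 1 / ((m:ℝ) - 1) by field_simp; ring,
    Real.rpow_add_of_nonneg hy (by norm_num) (by positivity), Real.rpow_one,
    Real.div_rpow (by positivity) hn.le, Real.mul_rpow ht.le hy]
  ring

lemma gauss_int (m : ℕ) (hm : Even m) (hm2 : 2 ≤ m) (c : ℝ) (hc : 0 < c) :
    ∃ C > (0:ℝ), ∀ n : ℕ, 1 ≤ n → ∀ ε : ℝ, 0 < ε →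
      ∫ ξ in (-ε)..ε, Real.exp (-(n * c) * ξ ^ m) ≤ C / (n:ℝ) ^ ((1:ℝ) / (m:ℝ)) := by
  have hm' : (2:ℝ) ≤ m := by exact_mod_cast hm2
  have hm0 : (0:ℝ) < m := by linarith
  refine ⟨2 * (c ^ (-1 / (m:ℝ)) * Real.Gamma (1 / (m:ℝ) + 1)), ?_, fun n hn ε hε => ?_⟩
  · have := Real.Gamma_pos_of_pos (show 0 < 1 / (m:ℝ) + 1 by positivity)
    positivity
  have hn' : (0:ℝ) < n := by exact_mod_cast hn
  have hb : 0 < (n:ℝ) * c := by positivity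
  have hcont : Continuous (fun ξ : ℝ => Real.exp (-(n * c) * ξ ^ m)) := by fun_prop
  have hsplit : ∫ ξ in (-ε)..ε, Real.exp (-(n * c) * ξ ^ m)
      = 2 * ∫ ξ in (0:ℝ)..ε, Real.exp (-(n * c) * ξ ^ m) := by
    rw [← intervalIntegral.integral_add_adjacent_intervals (b := 0)
      (hcont.intervalIntegrable _ _) (hcont.intervalIntegrable _ _)]
    have : ∫ ξ in (-ε)..0, Real.exp (-(n * c) * ξ ^ m)
        = ∫ ξ in (0:ℝ)..ε, Real.exp (-(n * c) * ξ ^ m) := by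
      have := intervalIntegral.integral_comp_neg (a := 0) (b := ε)
        (fun ξ : ℝ => Real.exp (-(n * c) * ξ ^ m))
      simp only [hm.neg_pow, neg_zero] at this
      exact this.symm
    rw [this]; ring
  have h2 := integral_exp_neg_mul_rpow hm0 hb
  have h3 := integrableOn_rpow_mul_exp_neg_mul_rpow (s := 0) (by norm_num) hm0 hb
  simp only [Real.rpow_zero, one_mul, Real.rpow_natCast] at h2 h3
  have h4 : ∫ ξ in (0:ℝ)..ε, Real.exp (-(n * c) * ξ ^ m)
      ≤ ((n:ℝ) * c) ^ (-1 / (m:ℝ)) * Real.Gamma (1 / (m:ℝ) + 1) := by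
    rw [← h2, intervalIntegral.integral_of_le hε.le]
    apply MeasureTheory.setIntegral_mono_set h3
    · exact Filter.Eventually.of_forall fun x => (Real.exp_pos _).le
    · exact (Set.Ioc_subset_Ioi_self).eventuallyLE
  rw [hsplit]
  calc _ ≤ 2 * (((n:ℝ) * c) ^ (-1 / (m:ℝ)) * Real.Gamma (1 / (m:ℝ) + 1)) := by linarith
    _ = _ := by
      rw [Real.mul_rpow hn'.le hc.le, neg_div, Real.rpow_neg hn'.le]
      field_simp

lemma local_integral (f : ℂ → ℂ) (hf : Differentiable ℂ f) (α : ℝ) (m : ℕ)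
    (hm : Even m) (hm2 : 2 ≤ m) (R c A : ℝ) (hR : 0 < R) (hc : 0 < c) (hA : 0 < A)
    (hfb : ∀ ζ : ℂ, ‖ζ‖ ≤ R →
      ‖f ζ‖ ≤ Real.exp (α * ζ.im - c * ζ.re ^ m + A * ζ.im ^ m)) (B : ℝ) (hB : 0 < B) :
    ∀ᶠ ε : ℝ in nhdsWithin 0 (Set.Ioi 0), ∃ C > (0:ℝ), ∃ c1 > (0:ℝ), ∀ n : ℕ, 1 ≤ n → ∀ j : ℤ,
      |(j:ℝ) - α * n| ≤ B * n →
      ‖∫ ξ in (-ε)..ε, f (ξ:ℂ) ^ n * Complex.exp (Complex.I * j * (ξ:ℂ))‖ ≤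
        C * Real.exp (-c1 * n) + C / (n:ℝ) ^ ((1:ℝ) / (m:ℝ)) *
          Real.exp (-c1 * (|(j:ℝ) - α * n| / (n:ℝ) ^ ((1:ℝ) / (m:ℝ))) ^
            ((m:ℝ) / ((m:ℝ) - 1))) := by
  have hmr : (2:ℝ) ≤ m := by exact_mod_cast hm2
  have hm1 : (0:ℝ) < (m:ℝ) - 1 := by linarith
  have hRev : ∀ᶠ ε : ℝ in nhdsWithin 0 (Set.Ioi 0), ε < R / 2 :=
    nhdsWithin_le_nhds (eventually_lt_nhds (by positivity))
  filter_upwards [hRev, self_mem_nhdsWithin] with ε hεR hε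
  have hε : 0 < ε := hε
  -- choose η0
  have hη : ∃ η0 : ℝ, 0 < η0 ∧ η0 ≤ ε ∧ B * η0 + A * η0 ^ m ≤ c * ε ^ m / 2 := by
    have hcont : Continuous (fun x : ℝ => B * x + A * x ^ m) := by fun_prop
    have h1 : ∀ᶠ x : ℝ in nhdsWithin 0 (Set.Ioi 0), B * x + A * x ^ m < c * ε ^ m / 2 := by
      apply nhdsWithin_le_nhds
      apply hcont.continuousAt.eventually_lt_const
      beta_reduce
      rw [zero_pow (by omega)]
      simp only [mul_zero, add_zero]
      positivity
    have h2 : ∀ᶠ x : ℝ in nhdsWithin 0 (Set.Ioi 0), x < ε :=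
      nhdsWithin_le_nhds (eventually_lt_nhds hε)
    have h3 : ∀ᶠ x : ℝ in nhdsWithin 0 (Set.Ioi 0), 0 < x := self_mem_nhdsWithin
    obtain ⟨x, a, b, d⟩ := (h1.and (h2.and h3)).exists
    exact ⟨x, d, b.le, a.le⟩
  obtain ⟨η0, hη0, hη0ε, hη0B⟩ := hη
  -- choose t
  obtain ⟨t, ht, htA, htB⟩ : ∃ t : ℝ, 0 < t ∧ A * t ≤ 1 / 2 ∧ t * B ≤ η0 ^ ((m:ℝ) - 1) := by
    refine ⟨min (1 / (2 * A)) (η0 ^ ((m:ℝ) - 1) / B), by positivity, ?_, ?_⟩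
    · calc _ ≤ A * (1 / (2 * A)) := by gcongr; exact min_le_left _ _
        _ = 1/2 := by field_simp
    · calc _ ≤ (η0 ^ ((m:ℝ) - 1) / B) * B := by gcongr; exact min_le_right _ _
        _ = _ := by field_simp
  obtain ⟨G, hG, hgauss⟩ := gauss_int m hm hm2 c hc
  set τ := t ^ ((1:ℝ) / ((m:ℝ) - 1)) with hτ
  have hτ0 : 0 < τ := by positivity
  refine ⟨max (2 * η0) G, by positivity, min (c * ε ^ m / 2) (τ / 2), by positivity, ?_⟩
  intro n hn j hj
  have hn' : (0:ℝ) < n := by exact_mod_cast hn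
  set x := (j:ℝ) - α * n with hx
  set η := (t * |x| / n) ^ ((1:ℝ) / ((m:ℝ) - 1)) with hηd
  have hηnn : 0 ≤ η := by positivity
  have hyη : |x| * η = τ * (|x| / (n:ℝ) ^ ((1:ℝ) / (m:ℝ))) ^ ((m:ℝ) / ((m:ℝ) - 1)) :=
    rpow_aux m hm2 t |x| n ht (abs_nonneg _) hn'
  have hηpow : η ^ (m - 1) = t * |x| / n := by
    rw [← Real.rpow_natCast, hηd, ← Real.rpow_mul (by positivity), Nat.cast_sub (by omega)]
    rw [Nat.cast_one, one_div, inv_mul_cancel₀ hm1.ne', Real.rpow_one]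
  have hηle : η ≤ η0 := by
    have : η0 = (η0 ^ ((m:ℝ) - 1)) ^ ((1:ℝ) / ((m:ℝ) - 1)) := by
      rw [← Real.rpow_mul hη0.le, mul_one_div, div_self hm1.ne', Real.rpow_one]
    rw [this, hηd]
    apply Real.rpow_le_rpow (by positivity) _ (by positivity)
    refine le_trans ?_ htB
    rw [div_le_iff₀ hn']
    calc t * |x| ≤ t * (B * n) := by gcongr
      _ = _ := by ring
  have hηm : n * (A * η ^ m) ≤ |x| * η / 2 := by
    have e : η ^ m = η ^ (m-1) * η := by rw [← pow_succ]; congr 1; omega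
    rw [e, hηpow]
    have : n * (A * (t * |x| / n * η)) = (A * t) * (|x| * η) := by field_simp
    rw [this]
    have : 0 ≤ |x| * η := by positivity
    nlinarith
  -- the signed shift
  obtain ⟨s, hs, hsx⟩ : ∃ s : ℝ, |s| = η ∧ x * s = |x| * η := by
    rcases le_total 0 x with h | h
    · exact ⟨η, abs_of_nonneg hηnn, by rw [abs_of_nonneg h]⟩
    · exact ⟨-η, by rw [abs_neg, abs_of_nonneg hηnn], by rw [abs_of_nonpos h]; ring⟩
  set h : ℂ → ℂ := fun ζ => f ζ ^ n * Complex.exp (Complex.I * j * ζ) with hh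
  have hhd : Differentiable ℂ h := by fun_prop
  have hhb : ∀ u v : ℝ, |u| ≤ ε → |v| ≤ ε →
      ‖h (u + v * Complex.I)‖ ≤ Real.exp (-(x * v) - n * (c * u ^ m) + n * (A * v ^ m)) := by
    intro u v hu hv
    have hre : ((u:ℂ) + v * Complex.I).re = u := by simp
    have him : ((u:ℂ) + v * Complex.I).im = v := by simp
    have h1 := hfb (u + v * Complex.I) (by
      have := Complex.norm_le_abs_re_add_abs_im ((u:ℂ) + v * Complex.I)
      rw [hre, him] at this
      linarith)
    rw [hre, him] at h1
    have h2 : ‖Complex.exp (Complex.I * j * ((u:ℂ) + v * Complex.I))‖ = Real.exp (-(j * v)) := by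
      rw [Complex.norm_exp]
      congr 1
      simp [Complex.mul_re, Complex.mul_im]
    simp only [hh]
    rw [norm_mul, norm_pow, h2]
    calc _ ≤ (Real.exp (α * v - c * u ^ m + A * v ^ m)) ^ n * Real.exp (-(j * v)) := by gcongr
      _ = _ := by
        rw [← Real.exp_nat_mul, ← Real.exp_add]
        congr 1
        rw [hx]; ring
  have hrect := Complex.integral_boundary_rect_eq_zero_of_differentiableOn h
    (((-ε : ℝ):ℂ)) ((ε:ℂ) + s * Complex.I) hhd.differentiableOn
  have e1 : ((ε:ℂ) + s * Complex.I).re = ε := by simp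
  have e2 : ((ε:ℂ) + s * Complex.I).im = s := by simp
  rw [e1, e2, Complex.ofReal_re, Complex.ofReal_im] at hrect
  simp only [Complex.ofReal_zero, zero_mul, add_zero] at hrect
  have hmain : ∫ ξ in (-ε)..ε, h ξ = (∫ ξ in (-ε)..ε, h (ξ + s * Complex.I))
      - Complex.I • (∫ y in (0:ℝ)..s, h ((ε:ℂ) + y * Complex.I))
      + Complex.I • (∫ y in (0:ℝ)..s, h (((-ε:ℝ):ℂ) + y * Complex.I)) := by
    linear_combination hrect
  have hvert : ∀ u : ℝ, |u| = ε → ‖Complex.I • (∫ y in (0:ℝ)..s, h ((u:ℂ) + y * Complex.I))‖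
      ≤ η0 * Real.exp (-(c * ε ^ m / 2) * n) := by
    intro u hu
    rw [norm_smul, Complex.norm_I, one_mul]
    have := intervalIntegral.norm_integral_le_of_norm_le_const (a := 0) (b := s)
      (f := fun y : ℝ => h ((u:ℂ) + y * Complex.I)) (C := Real.exp (-(c * ε ^ m / 2) * n)) (by
        intro y hy
        have hys : |y| ≤ η0 := by
          have : |y| ≤ |s| := by
            rcases Set.mem_uIoc.1 hy with h | h
            · rw [abs_of_pos h.1]; exact h.2.trans (le_abs_self _)
            · rw [abs_of_nonpos h.2]; exact (neg_le_neg h.1.le).trans (neg_le_abs _)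
          rw [hs] at this
          linarith
        refine (hhb u y hu.le (hys.trans hη0ε)).trans (Real.exp_le_exp.2 ?_)
        have a1 : -(x * y) ≤ (B * n) * η0 := by
          calc -(x * y) ≤ |x * y| := neg_le_abs _
            _ = |x| * |y| := abs_mul _ _
            _ ≤ _ := by gcongr
        have a2 : u ^ m = ε ^ m := by rw [← hm.pow_abs, hu]
        have a3 : y ^ m ≤ η0 ^ m := by rw [← hm.pow_abs]; gcongr
        have a4 : n * (A * y ^ m) ≤ n * (A * η0 ^ m) := by gcongr
        rw [a2]
        have a5 := mul_le_mul_of_nonneg_left hη0B hn'.le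
        linarith)
    refine this.trans ?_
    rw [sub_zero, hs, mul_comm]
    gcongr
  have hhor : ‖∫ ξ in (-ε)..ε, h (ξ + s * Complex.I)‖ ≤
      Real.exp (-(|x| * η / 2)) * (G / (n:ℝ) ^ ((1:ℝ) / (m:ℝ))) := by
    have hcont : Continuous (fun ξ : ℝ => Real.exp (-(|x| * η / 2)) *
      Real.exp (-(n * c) * ξ ^ m)) := by fun_prop
    have := intervalIntegral.norm_integral_le_of_norm_le (a := -ε) (b := ε)
      (μ := MeasureTheory.volume)
      (f := fun ξ : ℝ => h (ξ + s * Complex.I)) (g := fun ξ : ℝ => Real.exp (-(|x| * η / 2)) *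
        Real.exp (-(n * c) * ξ ^ m)) (by linarith) (Filter.Eventually.of_forall (by
        intro ξ hξ
        refine (hhb ξ s (abs_le.2 ⟨hξ.1.le, hξ.2⟩) (by rw [hs]; linarith)).trans ?_
        rw [← Real.exp_add]
        apply Real.exp_le_exp.2
        have : s ^ m = η ^ m := by rw [← hm.pow_abs, hs]
        rw [this, hsx]
        linarith)) (hcont.intervalIntegrable _ _)
    refine this.trans ?_
    rw [intervalIntegral.integral_const_mul]
    gcongr
    exact hgauss n hn ε hε
  have hfin : ‖∫ ξ in (-ε)..ε, h ξ‖ ≤ 2 * η0 * Real.exp (-(c * ε ^ m / 2) * n) +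
      Real.exp (-(|x| * η / 2)) * (G / (n:ℝ) ^ ((1:ℝ) / (m:ℝ))) := by
    rw [hmain]
    have v1 := hvert ε (abs_of_pos hε)
    have v2 := hvert (-ε) (by rw [abs_neg, abs_of_pos hε])
    have := norm_add_le ((∫ ξ in (-ε)..ε, h (ξ + s * Complex.I))
      - Complex.I • (∫ y in (0:ℝ)..s, h ((ε:ℂ) + y * Complex.I)))
      (Complex.I • (∫ y in (0:ℝ)..s, h (((-ε:ℝ):ℂ) + y * Complex.I)))
    have := norm_sub_le (∫ ξ in (-ε)..ε, h (ξ + s * Complex.I))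
      (Complex.I • (∫ y in (0:ℝ)..s, h ((ε:ℂ) + y * Complex.I)))
    linarith
  refine hfin.trans (add_le_add ?_ ?_)
  · gcongr
    · exact le_max_left _ _
    · exact min_le_left _ _
  · rw [mul_comm]
    gcongr
    · exact le_max_right _ _
    · rw [hyη, mul_div_right_comm, neg_mul, neg_le_neg_iff]
      gcongr
      exact min_le_right _ _

lemma symbol_one (r p : ℕ) (a1 : ℤ → ℂ)
    (h : ∀ ℓ ∈ Finset.Icc (-(r : ℤ)) (p : ℤ), a1 ℓ = if ℓ = 0 then 1 else 0) (κ : ℂ) :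
    symbol r p a1 κ = 1 := by
  unfold symbol
  rw [Finset.sum_eq_single (0:ℤ)]
  · rw [h 0 (by simp)]; simp
  · intro b hb hb0; rw [h b hb]; simp [hb0]
  · intro h0; exact absurd (by simp) h0

lemma convAct_one (r p : ℕ) (a1 : ℤ → ℂ)
    (h : ∀ ℓ ∈ Finset.Icc (-(r : ℤ)) (p : ℤ), a1 ℓ = if ℓ = 0 then 1 else 0)
    (u : ℤ → ℂ) (j : ℤ) : convAct r p a1 u j = u j := by
  unfold convAct
  rw [Finset.sum_eq_single (0:ℤ)]
  · rw [h 0 (by simp)]; simp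
  · intro b hb hb0; rw [h b hb]; simp [hb0]
  · intro h0; exact absurd (by simp) h0

lemma symbol_exp_diff (r p : ℕ) (a : ℤ → ℂ) (w : ℂ) :
    Differentiable ℂ (fun ζ : ℂ => symbol r p a (Complex.exp (Complex.I * (w + ζ)))) := by
  unfold symbol
  simp_rw [← Complex.exp_int_mul]
  fun_prop

lemma symbol_exp_diff0 (r p : ℕ) (a : ℤ → ℂ) :
    Differentiable ℂ (fun ζ : ℂ => symbol r p a (Complex.exp (Complex.I * ζ))) := by
  simpa using symbol_exp_diff r p a 0

lemma green_formula (S : Setup)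
    (hQ1id : ∀ ℓ ∈ Finset.Icc (-(S.r : ℤ)) (S.p : ℤ), S.a1 ℓ = if ℓ = 0 then 1 else 0)
    (θ : ℝ) (n : ℕ) : ∀ j : ℤ, ∫ ξ in θ..(θ + 2 * Real.pi),
      symbol S.r S.p S.a0 (Complex.exp (Complex.I * (ξ:ℂ))) ^ n *
        Complex.exp (Complex.I * j * (ξ:ℂ)) = 2 * Real.pi * ((S.L ^ n) dirac) j := by
  induction n with
  | zero =>
    intro j
    simp only [pow_zero, one_mul]
    by_cases hj : j = 0
    · subst hj
      simp [dirac]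
    · rw [integral_exp_mul_complex (by simp [hj])]
      have : Complex.exp (Complex.I * j * ((θ + 2 * Real.pi : ℝ) : ℂ))
          = Complex.exp (Complex.I * j * (θ : ℂ)) := by
        rw [Complex.exp_eq_exp_iff_exists_int]
        exact ⟨j, by push_cast; ring⟩
      rw [this, sub_self, zero_div]
      have : ((1 : Seq2 →L[ℂ] Seq2) dirac) j = 0 := by
        simp [dirac, lp.single_apply, hj]
      rw [this, mul_zero]
  | succ n ih =>
    intro j
    have h1 : ((S.L ^ (n+1)) dirac) j = convAct S.r S.p S.a0 (fun i => ((S.L ^ n) dirac) i) j := by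
      rw [← S.hL, convAct_one _ _ _ hQ1id, pow_succ']
      rfl
    rw [h1]
    unfold convAct
    rw [Finset.mul_sum]
    have hd := (symbol_exp_diff0 S.r S.p S.a0).continuous
    have h2 : ∀ ξ : ℝ, symbol S.r S.p S.a0 (Complex.exp (Complex.I * (ξ:ℂ))) ^ (n+1) *
        Complex.exp (Complex.I * j * (ξ:ℂ)) = ∑ ℓ ∈ Finset.Icc (-(S.r : ℤ)) (S.p : ℤ),
          S.a0 ℓ * (symbol S.r S.p S.a0 (Complex.exp (Complex.I * (ξ:ℂ))) ^ n *
        Complex.exp (Complex.I * ((j + ℓ : ℤ):ℂ) * (ξ:ℂ))) := by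
      intro ξ
      rw [pow_succ]
      conv_lhs => enter [1, 2]; unfold symbol
      rw [Finset.mul_sum, Finset.sum_mul]
      refine Finset.sum_congr rfl fun ℓ _ => ?_
      rw [← Complex.exp_int_mul, show Complex.I * ((j + ℓ : ℤ):ℂ) * (ξ:ℂ)
        = ℓ * (Complex.I * ξ) + Complex.I * j * ξ by push_cast; ring, Complex.exp_add]
      ring
    simp_rw [h2]
    rw [intervalIntegral.integral_finsetSum]
    · refine Finset.sum_congr rfl fun ℓ _ => ?_
      rw [intervalIntegral.integral_const_mul, ih (j + ℓ)]
      ring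
    · intro ℓ _
      apply Continuous.intervalIntegrable
      have : Continuous fun ξ : ℝ => symbol S.r S.p S.a0 (Complex.exp (Complex.I * (ξ:ℂ))) :=
        hd.comp Complex.continuous_ofReal
      fun_prop

lemma exists_base (S : Setup) : ∃ θ : ℝ, ∃ x : Fin S.K → ℝ,
    (∀ k, θ < x k ∧ x k < θ + 2 * Real.pi) ∧
    ∀ k, Complex.exp (Complex.I * (x k : ℂ)) = S.kap k := by
  have hpi := Real.pi_pos
  have h1 : ∃ θ : ℝ, ∀ k, Complex.exp (Complex.I * (θ : ℂ)) ≠ S.kap k := by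
    have hinf : (Set.Ioo (0:ℝ) 1).Infinite := Set.Ioo_infinite (by norm_num)
    have hinj : Set.InjOn (fun θ : ℝ => Complex.exp (Complex.I * (θ : ℂ))) (Set.Ioo (0:ℝ) 1) := by
      intro a ha b hb hab
      obtain ⟨k, hk⟩ := Complex.exp_eq_exp_iff_exists_int.1 hab
      have hk' : a = b + k * (2 * Real.pi) := by
        have : (Complex.I * (a:ℂ)) = Complex.I * ((b + k * (2 * Real.pi) : ℝ) : ℂ) := by
          rw [hk]; push_cast; ring
        exact_mod_cast mul_left_cancel₀ Complex.I_ne_zero this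
      have h3 := Real.pi_gt_three
      have : k = 0 := by
        have u : (k:ℝ) < 1 := by by_contra! h; nlinarith [ha.1, ha.2, hb.1, hb.2]
        have v : (-1:ℝ) < k := by by_contra! h; nlinarith [ha.1, ha.2, hb.1, hb.2]
        have u' : k < 1 := by exact_mod_cast u
        have v' : -1 < k := by exact_mod_cast v
        omega
      rw [hk', this]; simp
    have := hinf.image hinj
    obtain ⟨y, hy, hy2⟩ := this.exists_notMem_finite (Set.finite_range S.kap)
    obtain ⟨θ, _, rfl⟩ := hy
    exact ⟨θ, fun k h => hy2 ⟨k, h.symm⟩⟩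
  obtain ⟨θ, hθ⟩ := h1
  have h2pi : 0 < 2 * Real.pi := by positivity
  have hx : ∀ k, Complex.exp (Complex.I * ((toIocMod h2pi θ (S.kap k).arg : ℝ) : ℂ)) = S.kap k := by
    intro k
    have e : S.kap k = Complex.exp (Complex.I * ((S.kap k).arg : ℂ)) := by
      have := Complex.norm_mul_exp_arg_mul_I (S.kap k)
      rw [S.hkap_unit] at this
      rw [Complex.ofReal_one, one_mul] at this
      rw [mul_comm]; exact this.symm
    conv_rhs => rw [e]
    rw [Complex.exp_eq_exp_iff_exists_int]
    refine ⟨-toIocDiv h2pi θ (S.kap k).arg, ?_⟩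
    rw [toIocMod]
    push_cast
    simp only [zsmul_eq_mul]
    push_cast
    ring
  refine ⟨θ, fun k => toIocMod h2pi θ (S.kap k).arg, fun k => ⟨left_lt_toIocMod _ _ _, ?_⟩, hx⟩
  refine lt_of_le_of_ne (toIocMod_le_right _ _ _) fun h => hθ k ?_
  beta_reduce at h
  rw [← hx k, h]
  rw [Complex.exp_eq_exp_iff_exists_int]
  exact ⟨-1, by push_cast; ring⟩

lemma exp_inj_window (a b θ : ℝ) (ha : θ ≤ a) (ha' : a ≤ θ + 2 * Real.pi) (hb : θ < b)
    (hb' : b < θ + 2 * Real.pi)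
    (hab : Complex.exp (Complex.I * (a : ℂ)) = Complex.exp (Complex.I * (b : ℂ))) : a = b := by
  obtain ⟨k, hk⟩ := Complex.exp_eq_exp_iff_exists_int.1 hab
  have hk' : a = b + k * (2 * Real.pi) := by
    have : (Complex.I * (a:ℂ)) = Complex.I * ((b + k * (2 * Real.pi) : ℝ) : ℂ) := by
      rw [hk]; push_cast; ring
    exact_mod_cast mul_left_cancel₀ Complex.I_ne_zero this
  have h3 := Real.pi_gt_three
  have : k = 0 := by
    have u : (k:ℝ) < 1 := by by_contra! h; nlinarith
    have v : (-1:ℝ) < k := by by_contra! h; nlinarith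
    have u' : k < 1 := by exact_mod_cast u
    have v' : -1 < k := by exact_mod_cast v
    omega
  rw [hk', this]; simp

set_option maxHeartbeats 1600000 in
lemma green_sum (S : Setup)
    (hQ1id : ∀ ℓ ∈ Finset.Icc (-(S.r : ℤ)) (S.p : ℤ), S.a1 ℓ = if ℓ = 0 then 1 else 0)
    (B : ℝ) (hB : 0 < B) :
    ∃ C > (0:ℝ), ∃ c > (0:ℝ), ∀ n : ℕ, 1 ≤ n → ∀ j : ℤ,
      (∀ ν, |(j:ℝ) - S.α ν * n| ≤ B * n) →
      ‖((S.L ^ n) dirac) j‖ ≤ C * Real.exp (-c * n) +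
        ∑ ν, C / (n:ℝ) ^ ((1:ℝ) / ((2 * S.μ ν : ℕ):ℝ)) *
          Real.exp (-c * (|(j:ℝ) - S.α ν * n| / (n:ℝ) ^ ((1:ℝ) / ((2 * S.μ ν : ℕ):ℝ))) ^
            (((2 * S.μ ν : ℕ):ℝ) / (((2 * S.μ ν : ℕ):ℝ) - 1))) := by
  have hpi := Real.pi_pos
  have hF : ∀ κ, Fsym S.r S.p S.a0 S.a1 κ = symbol S.r S.p S.a0 κ := by
    intro κ; unfold Fsym; rw [symbol_one _ _ _ hQ1id, div_one]
  obtain ⟨θ, x, hxI, hxk⟩ := exists_base S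
  have hxinj : ∀ ν ν', ν ≠ ν' → x ν ≠ x ν' := by
    intro ν ν' hne h
    apply hne; apply S.hkap_inj; rw [← hxk, ← hxk, h]
  set P : ℂ → ℂ := fun ζ => symbol S.r S.p S.a0 (Complex.exp (Complex.I * ζ)) with hP
  have hPd : Differentiable ℂ P := symbol_exp_diff0 _ _ _
  have hPc : Continuous (fun ξ : ℝ => P ξ) := hPd.continuous.comp Complex.continuous_ofReal
  have hloc : ∀ ν, ∀ᶠ ε : ℝ in nhdsWithin 0 (Set.Ioi 0), ∃ C > (0:ℝ), ∃ c1 > (0:ℝ),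
      ∀ n : ℕ, 1 ≤ n → ∀ j : ℤ, |(j:ℝ) - S.α ν * n| ≤ B * n →
      ‖∫ ξ in (-ε)..ε, P ((x ν : ℂ) + ξ) ^ n * Complex.exp (Complex.I * j * (ξ:ℂ))‖ ≤
        C * Real.exp (-c1 * n) + C / (n:ℝ) ^ ((1:ℝ) / ((2 * S.μ ν : ℕ):ℝ)) *
          Real.exp (-c1 * (|(j:ℝ) - S.α ν * n| / (n:ℝ) ^ ((1:ℝ) / ((2 * S.μ ν : ℕ):ℝ))) ^
            (((2 * S.μ ν : ℕ):ℝ) / (((2 * S.μ ν : ℕ):ℝ) - 1))) := by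
    intro ν
    obtain ⟨g, hg, hfg⟩ := S.hexp ν
    have hd : Differentiable ℂ (fun ζ : ℂ => P ((x ν : ℂ) + ζ)) := symbol_exp_diff _ _ _ _
    obtain ⟨R, hR, c, hc, A, hA, hb⟩ := local_bound (fun ζ : ℂ => P ((x ν : ℂ) + ζ)) hd
      (S.α ν) (S.β ν) (S.hβ ν) (2 * S.μ ν) (even_two_mul _) _ (S.hF_unit ν) g hg (by
        filter_upwards [hfg] with ξ h
        rw [← h, hF (S.kap ν * _)]
        simp only [hP]
        rw [mul_add, Complex.exp_add, hxk])
    have := S.hμ ν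
    exact local_integral _ hd (S.α ν) (2 * S.μ ν) (even_two_mul _) (by omega) R c A hR hc hA hb B hB
  have hloc' := Filter.eventually_all.2 hloc
  have hlt : ∀ d : ℝ, 0 < d → ∀ᶠ ε : ℝ in nhdsWithin 0 (Set.Ioi 0), ε < d :=
    fun d hd => nhdsWithin_le_nhds (eventually_lt_nhds hd)
  have hw1 : ∀ᶠ ε : ℝ in nhdsWithin 0 (Set.Ioi 0), ∀ ν, ε < x ν - θ :=
    Filter.eventually_all.2 fun ν => hlt _ (by linarith [(hxI ν).1])
  have hw2 : ∀ᶠ ε : ℝ in nhdsWithin 0 (Set.Ioi 0), ∀ ν, ε < θ + 2 * Real.pi - x ν :=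
    Filter.eventually_all.2 fun ν => hlt _ (by linarith [(hxI ν).2])
  have hw3 : ∀ᶠ ε : ℝ in nhdsWithin 0 (Set.Ioi 0), ∀ ν, ∀ ν', ν ≠ ν' → ε < |x ν - x ν'| / 2 :=
    Filter.eventually_all.2 fun ν => Filter.eventually_all.2 fun ν' => by
      by_cases h : ν = ν'
      · simp [h]
      · have : 0 < |x ν - x ν'| := abs_pos.2 (sub_ne_zero.2 (hxinj ν ν' h))
        filter_upwards [hlt _ (half_pos this)] with ε hε _ using hε
  have hw4 : ∀ᶠ ε : ℝ in nhdsWithin 0 (Set.Ioi 0), 0 < ε := self_mem_nhdsWithin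
  obtain ⟨ε, hL, h1, h2, h3, hε⟩ := (hloc'.and (hw1.and (hw2.and (hw3.and hw4)))).exists
  choose C hC c hc hbd using hL
  -- bound away from the tangency points
  set Kc : Set ℝ := Set.Icc θ (θ + 2 * Real.pi) \ ⋃ ν, Set.Ioo (x ν - ε) (x ν + ε) with hKc
  have hKcomp : IsCompact Kc := isCompact_Icc.diff (isOpen_iUnion fun ν => isOpen_Ioo)
  have hKlt : ∀ ξ ∈ Kc, ‖P ξ‖ < 1 := by
    intro ξ hξ
    have := S.hF_lt (Complex.exp (Complex.I * ξ)) (by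
      rw [mul_comm]; exact Complex.norm_exp_ofReal_mul_I ξ) (by
      intro k hk
      rw [← hxk k] at hk
      have := exp_inj_window ξ (x k) θ hξ.1.1 hξ.1.2 (hxI k).1 (hxI k).2 hk
      apply hξ.2
      rw [Set.mem_iUnion]
      exact ⟨k, by rw [this]; constructor <;> linarith⟩)
    rwa [hF] at this
  obtain ⟨c0, hc0, hKb⟩ : ∃ c0 > (0:ℝ), ∀ ξ ∈ Kc, ‖P ξ‖ ≤ Real.exp (-c0) := by
    have key : ∃ q : ℝ, 0 < q ∧ q < 1 ∧ ∀ ξ ∈ Kc, ‖P ξ‖ ≤ q := by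
      rcases Kc.eq_empty_or_nonempty with he | hne
      · exact ⟨1/2, by norm_num, by norm_num, by simp [he]⟩
      · obtain ⟨ξ0, hξ0, hmax⟩ := hKcomp.exists_isMaxOn hne hPc.norm.continuousOn
        exact ⟨max (1/2) ‖P ξ0‖, by positivity, max_lt (by norm_num) (hKlt _ hξ0),
          fun ξ hξ => (hmax hξ).trans (le_max_right _ _)⟩
    obtain ⟨q, hq0, hq1, hq⟩ := key
    refine ⟨-Real.log q, by simpa using Real.log_neg hq0 hq1, fun ξ hξ => ?_⟩
    rw [neg_neg, Real.exp_log hq0]; exact hq ξ hξ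
  -- common constants
  obtain ⟨cm, hcm, hcm0, hcmν⟩ : ∃ cm : ℝ, 0 < cm ∧ cm ≤ c0 ∧ ∀ ν, cm ≤ c ν := by
    have h := (hlt c0 hc0).and ((Filter.eventually_all.2 fun ν => hlt (c ν) (hc ν)).and hw4)
    obtain ⟨y, a, b, d⟩ := h.exists
    exact ⟨y, d, a.le, fun ν => (b ν).le⟩
  refine ⟨2 * Real.pi + ∑ ν, C ν, ?_, cm, hcm, ?_⟩
  · have : 0 ≤ ∑ ν, C ν := Finset.sum_nonneg fun ν _ => (hC ν).le
    positivity
  intro n hn j hj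
  have hn' : (0:ℝ) < n := by exact_mod_cast hn
  set h : ℝ → ℂ := fun ξ => P ξ ^ n * Complex.exp (Complex.I * j * (ξ:ℂ)) with hh
  have hhc : Continuous h := (hPc.pow n).mul (by fun_prop)
  have hform := green_formula S hQ1id θ n j
  have hsplit : (∫ ξ in Set.Ioc θ (θ + 2 * Real.pi), h ξ) =
      (∫ ξ in Set.Ioc θ (θ + 2 * Real.pi) \ ⋃ ν ∈ (Finset.univ : Finset (Fin S.K)),
        Set.Ioc (x ν - ε) (x ν + ε), h ξ) +
      ∑ ν, ∫ ξ in Set.Ioc (x ν - ε) (x ν + ε), h ξ := by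
    rw [← MeasureTheory.integral_biUnion_finset Finset.univ (fun _ _ => measurableSet_Ioc),
      MeasureTheory.setIntegral_sdiff, sub_add_cancel]
    · exact Finset.measurableSet_biUnion _ fun _ _ => measurableSet_Ioc
    · exact hhc.integrableOn_Ioc
    · intro y hy
      simp only [Set.mem_iUnion] at hy
      obtain ⟨ν, _, hy⟩ := hy
      exact ⟨by linarith [hy.1, h1 ν], by linarith [hy.2, h2 ν]⟩
    · intro ν _ ν' _ hne
      rw [Function.onFun, Set.disjoint_left]
      intro y hy hy'
      have := h3 ν ν' hne
      have : |x ν - x ν'| < 2 * ε := by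
        rw [abs_lt]; constructor <;> linarith [hy.1, hy.2, hy'.1, hy'.2]
      linarith
    · intro ν _; exact hhc.integrableOn_Ioc
  have hout : ‖∫ ξ in Set.Ioc θ (θ + 2 * Real.pi) \ ⋃ ν ∈ (Finset.univ : Finset (Fin S.K)),
        Set.Ioc (x ν - ε) (x ν + ε), h ξ‖ ≤ 2 * Real.pi * Real.exp (-cm * n) := by
    have hvol : MeasureTheory.volume (Set.Ioc θ (θ + 2 * Real.pi)) ≠ ⊤ := measure_Ioc_lt_top.ne
    have := MeasureTheory.norm_setIntegral_le_of_norm_le_const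
      (μ := MeasureTheory.volume) (f := h) (C := Real.exp (-cm * n))
      (s := Set.Ioc θ (θ + 2 * Real.pi) \ ⋃ ν ∈ (Finset.univ : Finset (Fin S.K)),
        Set.Ioc (x ν - ε) (x ν + ε))
      ((MeasureTheory.measure_mono Set.sdiff_subset).trans_lt hvol.lt_top) (by
        intro ξ hξ
        have hξK : ξ ∈ Kc := by
          refine ⟨⟨hξ.1.1.le, hξ.1.2⟩, fun hm => hξ.2 ?_⟩
          simp only [Set.mem_iUnion] at hm ⊢
          obtain ⟨ν, hm⟩ := hm
          exact ⟨ν, Finset.mem_univ _, hm.1, hm.2.le⟩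
        have e : ‖Complex.exp (Complex.I * j * (ξ:ℂ))‖ = 1 := by
          rw [Complex.norm_exp]; simp [Complex.mul_re]
        simp only [hh]
        rw [norm_mul, norm_pow, e, mul_one]
        calc ‖P ξ‖ ^ n ≤ (Real.exp (-c0)) ^ n := by gcongr; exact hKb ξ hξK
          _ = Real.exp (n * -c0) := (Real.exp_nat_mul _ _).symm
          _ ≤ _ := by apply Real.exp_le_exp.2; nlinarith)
    refine this.trans ?_
    rw [mul_comm]
    gcongr
    refine (MeasureTheory.measureReal_mono Set.sdiff_subset hvol).trans ?_
    rw [Real.volume_real_Ioc_of_le (by linarith)]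
    linarith
  have hin : ∀ ν, ‖∫ ξ in Set.Ioc (x ν - ε) (x ν + ε), h ξ‖ ≤ C ν * Real.exp (-cm * n) +
      C ν / (n:ℝ) ^ ((1:ℝ) / ((2 * S.μ ν : ℕ):ℝ)) *
          Real.exp (-cm * (|(j:ℝ) - S.α ν * n| / (n:ℝ) ^ ((1:ℝ) / ((2 * S.μ ν : ℕ):ℝ))) ^
            (((2 * S.μ ν : ℕ):ℝ) / (((2 * S.μ ν : ℕ):ℝ) - 1))) := by
    intro ν
    rw [← intervalIntegral.integral_of_le (by linarith), sub_eq_add_neg,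
      ← intervalIntegral.integral_comp_add_left]
    have e : ∀ ξ : ℝ, h (x ν + ξ) = Complex.exp (Complex.I * j * (x ν : ℂ)) *
        (P ((x ν : ℂ) + ξ) ^ n * Complex.exp (Complex.I * j * (ξ:ℂ))) := by
      intro ξ
      simp only [hh]
      push_cast
      rw [mul_add (Complex.I * j), Complex.exp_add]
      ring
    simp_rw [e]
    rw [intervalIntegral.integral_const_mul, norm_mul]
    have e1 : ‖Complex.exp (Complex.I * j * (x ν : ℂ))‖ = 1 := by
      rw [Complex.norm_exp]; simp [Complex.mul_re]
    rw [e1, one_mul]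
    refine (hbd ν n hn j (hj ν)).trans ?_
    have hCν := hC ν
    have hcν := hcmν ν
    gcongr
  have hG : ‖((S.L ^ n) dirac) j‖ ≤ ‖∫ ξ in Set.Ioc θ (θ + 2 * Real.pi), h ξ‖ := by
    rw [← intervalIntegral.integral_of_le (by linarith)]
    have e : ∫ ξ in θ..(θ + 2 * Real.pi), h ξ = 2 * Real.pi * ((S.L ^ n) dirac) j := hform
    rw [e, norm_mul, norm_mul, Complex.norm_real, Real.norm_of_nonneg hpi.le, Complex.norm_ofNat]
    have h3 := Real.pi_gt_three
    have := norm_nonneg (((S.L ^ n) dirac) j)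
    nlinarith
  refine hG.trans ?_
  rw [hsplit]
  refine (norm_add_le _ _).trans ?_
  have hsum := (norm_sum_le Finset.univ fun ν => ∫ ξ in Set.Ioc (x ν - ε) (x ν + ε), h ξ).trans
    (Finset.sum_le_sum fun ν _ => hin ν)
  refine (add_le_add hout hsum).trans ?_
  rw [Finset.sum_add_distrib, ← add_assoc, ← Finset.sum_mul, ← add_mul]
  gcongr with ν _
  have := Finset.single_le_sum (f := C) (fun ν _ => (hC ν).le) (Finset.mem_univ ν)
  linarith

lemma rpow_scale (m : ℕ) (hm : 2 ≤ m) (a n : ℝ) (ha : 0 ≤ a) (hn : 0 < n) :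
    (a * n / n ^ ((1:ℝ) / (m:ℝ))) ^ ((m:ℝ) / ((m:ℝ) - 1)) = a ^ ((m:ℝ) / ((m:ℝ) - 1)) * n := by
  have hm' : (2:ℝ) ≤ m := by exact_mod_cast hm
  have h1 : (0:ℝ) < (m:ℝ) - 1 := by linarith
  have e : a * n / n ^ ((1:ℝ) / (m:ℝ)) = a * n ^ (1 - (1:ℝ) / (m:ℝ)) := by
    rw [Real.rpow_sub hn, Real.rpow_one]; ring
  rw [e, Real.mul_rpow ha (by positivity), ← Real.rpow_mul hn.le,
    show (1 - (1:ℝ) / (m:ℝ)) * ((m:ℝ) / ((m:ℝ) - 1)) = 1 by field_simp, Real.rpow_one]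

/-- Lemma 12: in the explicit case, with pairwise distinct ordered drifts `α₁ < … < α_K` and
sectors `𝒟_k = {n δ̲_k ≤ j ≤ n δ̄_k}`, the temporal Green's function satisfies the generalized
gaussian bound inside each sector `𝒟_k`. -/
theorem temporal_green_sector_gaussian_bound (S : Setup)
    (hQ1id : ∀ ℓ ∈ Finset.Icc (-(S.r : ℤ)) (S.p : ℤ), S.a1 ℓ = if ℓ = 0 then 1 else 0)
    (hord : StrictMono S.α)
    (δlo δhi : Fin S.K → ℝ)
    (hlo : ∀ k, δlo k < S.α k) (hhi : ∀ k, S.α k < δhi k)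
    (hchain : ∀ (k : Fin S.K) (h : (k : ℕ) + 1 < S.K), δhi k < δlo ⟨(k : ℕ) + 1, h⟩)
    (hlop : ∀ k, -(S.p : ℝ) < δlo k) (hhir : ∀ k, δhi k < (S.r : ℝ))
    (hsgn : ∀ k, (0 < S.α k → 0 < δlo k) ∧ (S.α k < 0 → δhi k < 0)) :
    ∃ C > (0 : ℝ), ∃ M > (0 : ℝ), ∀ k : Fin S.K, ∀ n : ℕ, 1 ≤ n → ∀ j : ℤ,
      (n : ℝ) * δlo k ≤ (j : ℝ) → (j : ℝ) ≤ (n : ℝ) * δhi k →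
      ‖((S.L ^ n) dirac) j‖ ≤
        C / (n : ℝ) ^ ((1 : ℝ) / (2 * (S.μ k : ℝ))) *
          Real.exp (-(1 / M) * (|(j : ℝ) - S.α k * (n : ℝ)| /
              (n : ℝ) ^ ((1 : ℝ) / (2 * (S.μ k : ℝ)))) ^
            ((2 * (S.μ k : ℝ)) / (2 * (S.μ k : ℝ) - 1))) := by
  -- pointwise bounds for `j`
  obtain ⟨B, hB1, hBj⟩ : ∃ B : ℝ, 1 ≤ B ∧ ∀ k ν : Fin S.K, ∀ n : ℕ, 1 ≤ n → ∀ j : ℤ,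
      (n : ℝ) * δlo k ≤ (j : ℝ) → (j : ℝ) ≤ (n : ℝ) * δhi k →
      |(j:ℝ) - S.α ν * n| ≤ B * n := by
    refine ⟨1 + ∑ k, (|δlo k| + |δhi k|) + ∑ ν, |S.α ν|, ?_, ?_⟩
    · have a1 : 0 ≤ ∑ k, (|δlo k| + |δhi k|) := Finset.sum_nonneg fun k _ => by positivity
      have a2 : 0 ≤ ∑ ν, |S.α ν| := Finset.sum_nonneg fun k _ => by positivity
      linarith
    · intro k ν n hn j h1 h2
      have hn' : (0:ℝ) < n := by exact_mod_cast hn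
      have a1 : |δlo k| + |δhi k| ≤ ∑ k, (|δlo k| + |δhi k|) :=
        Finset.single_le_sum (f := fun k => |δlo k| + |δhi k|) (fun k _ => by positivity)
          (Finset.mem_univ k)
      have a2 : |S.α ν| ≤ ∑ ν, |S.α ν| :=
        Finset.single_le_sum (f := fun k => |S.α k|) (fun k _ => by positivity)
          (Finset.mem_univ ν)
      have b1 := mul_le_mul_of_nonneg_left a1 hn'.le
      have b2 := mul_le_mul_of_nonneg_left a2 hn'.le
      have c1 := mul_le_mul_of_nonneg_left (neg_abs_le (δlo k)) hn'.le
      have c2 := mul_le_mul_of_nonneg_left (le_abs_self (δhi k)) hn'.le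
      have c3 := mul_le_mul_of_nonneg_left (neg_abs_le (S.α ν)) hn'.le
      have c4 := mul_le_mul_of_nonneg_left (le_abs_self (S.α ν)) hn'.le
      have d1 : 0 ≤ n * |δlo k| := by positivity
      have d2 : 0 ≤ n * |δhi k| := by positivity
      rw [abs_le]
      constructor <;> nlinarith
  -- gap
  obtain ⟨d, hd0, hd1, hdj⟩ : ∃ d : ℝ, 0 < d ∧ d ≤ 1 ∧ ∀ k ν : Fin S.K, k ≠ ν →
      (d ≤ S.α ν - δhi k ∨ d ≤ δlo k - S.α ν) := by
    have hlt : ∀ d : ℝ, 0 < d → ∀ᶠ ε : ℝ in nhdsWithin 0 (Set.Ioi 0), ε < d :=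
      fun d hd => nhdsWithin_le_nhds (eventually_lt_nhds hd)
    have hw4 : ∀ᶠ ε : ℝ in nhdsWithin 0 (Set.Ioi 0), 0 < ε := self_mem_nhdsWithin
    have hall : ∀ᶠ ε : ℝ in nhdsWithin 0 (Set.Ioi 0), ∀ k ν : Fin S.K, k ≠ ν →
      (ε ≤ S.α ν - δhi k ∨ ε ≤ δlo k - S.α ν) := by
      refine Filter.eventually_all.2 fun k => Filter.eventually_all.2 fun ν => ?_
      rcases lt_trichotomy k ν with h | h | h
      · have hk1 : (k:ℕ) + 1 < S.K := by have := ν.2; have : (k:ℕ) < ν := h; omega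
        have a := hchain k hk1
        have b := hlo ⟨(k:ℕ) + 1, hk1⟩
        have c : S.α ⟨(k:ℕ) + 1, hk1⟩ ≤ S.α ν := hord.monotone (by
          rw [Fin.le_def]; exact h)
        filter_upwards [hlt (S.α ν - δhi k) (by linarith)] with ε hε _ using Or.inl hε.le
      · simp [h]
      · have hνk : (ν:ℕ) < k := h
        have hk2 := k.2
        have hk1 : ((k:ℕ) - 1) < S.K := by omega
        have a := hchain ⟨(k:ℕ) - 1, hk1⟩ (by simp only; omega)
        have e : (⟨(k:ℕ) - 1 + 1, by omega⟩ : Fin S.K) = k := by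
          ext; simp only; omega
        simp only [e] at a
        have b := hhi ⟨(k:ℕ) - 1, hk1⟩
        have c : S.α ν ≤ S.α ⟨(k:ℕ) - 1, hk1⟩ := hord.monotone (by
          rw [Fin.le_def]; simp only; omega)
        filter_upwards [hlt (δlo k - S.α ν) (by linarith)] with ε hε _ using Or.inr hε.le
    obtain ⟨y, a, b, c⟩ := (hall.and ((hlt 1 one_pos).and hw4)).exists
    exact ⟨y, c, b.le, a⟩
  have hB0 : 0 < B := by linarith
  obtain ⟨C, hC, c, hc, hsum⟩ := green_sum S hQ1id B hB0
  have hd2 : d ^ 2 ≤ 1 := by nlinarith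
  have hd2' : 0 < d ^ 2 := by positivity
  -- c3 is the common exponential rate
  set c3 := c * d ^ 2 with hc3
  have hc30 : 0 < c3 := by positivity
  have hc3c : c3 ≤ c := by nlinarith
  set c4 := min c (c3 / (2 * B ^ 2)) with hc4
  have hc40 : 0 < c4 := by positivity
  refine ⟨C * (1 + S.K) * (2 / c3) + C, by positivity, 1 / c4, by positivity, ?_⟩
  intro k n hn j hj1 hj2
  have hn' : (0:ℝ) < n := by exact_mod_cast hn
  have hn1 : (1:ℝ) ≤ n := by exact_mod_cast hn
  have hmain := hsum n hn j (fun ν => hBj k ν n hn j hj1 hj2)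
  have hm2 : ∀ ν, 2 ≤ 2 * S.μ ν := fun ν => by have := S.hμ ν; omega
  have hmr : ∀ ν, (2:ℝ) ≤ ((2 * S.μ ν : ℕ) : ℝ) := fun ν => by exact_mod_cast hm2 ν
  have hexpo : ∀ ν, 0 < ((2 * S.μ ν : ℕ) : ℝ) / (((2 * S.μ ν : ℕ) : ℝ) - 1) ∧
      ((2 * S.μ ν : ℕ) : ℝ) / (((2 * S.μ ν : ℕ) : ℝ) - 1) ≤ 2 := fun ν => by
    have := hmr ν
    refine ⟨div_pos (by linarith) (by linarith), ?_⟩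
    rw [div_le_iff₀ (by linarith)]; linarith
  -- terms with ν ≠ k
  have hoff : ∀ ν ∈ Finset.univ.erase k, C / (n:ℝ) ^ ((1:ℝ) / ((2 * S.μ ν : ℕ):ℝ)) *
          Real.exp (-c * (|(j:ℝ) - S.α ν * n| / (n:ℝ) ^ ((1:ℝ) / ((2 * S.μ ν : ℕ):ℝ))) ^
            (((2 * S.μ ν : ℕ):ℝ) / (((2 * S.μ ν : ℕ):ℝ) - 1))) ≤ C * Real.exp (-c3 * n) := by
    intro ν hν
    have hne : k ≠ ν := (Finset.ne_of_mem_erase hν).symm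
    have habs : d * n ≤ |(j:ℝ) - S.α ν * n| := by
      rcases hdj k ν hne with h | h
      · have := mul_le_mul_of_nonneg_right h hn'.le
        have := neg_abs_le ((j:ℝ) - S.α ν * n)
        linarith
      · have := mul_le_mul_of_nonneg_right h hn'.le
        have := le_abs_self ((j:ℝ) - S.α ν * n)
        linarith
    have h1 : d ^ 2 * n ≤ (|(j:ℝ) - S.α ν * n| / (n:ℝ) ^ ((1:ℝ) / ((2 * S.μ ν : ℕ):ℝ))) ^
            (((2 * S.μ ν : ℕ):ℝ) / (((2 * S.μ ν : ℕ):ℝ) - 1)) := by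
      calc d ^ 2 * n ≤ d ^ (((2 * S.μ ν : ℕ):ℝ) / (((2 * S.μ ν : ℕ):ℝ) - 1)) * n := by
            gcongr
            rw [← Real.rpow_natCast]
            exact Real.rpow_le_rpow_of_exponent_ge hd0 hd1 (by exact_mod_cast (hexpo ν).2)
        _ = _ := (rpow_scale _ (hm2 ν) d n hd0.le hn').symm
        _ ≤ _ := by
            apply Real.rpow_le_rpow (by positivity) _ (hexpo ν).1.le
            gcongr
    have h2 : C / (n:ℝ) ^ ((1:ℝ) / ((2 * S.μ ν : ℕ):ℝ)) ≤ C :=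
      div_le_self hC.le (Real.one_le_rpow hn1 (by positivity))
    apply mul_le_mul h2 _ (Real.exp_pos _).le hC.le
    apply Real.exp_le_exp.2
    have := mul_le_mul_of_nonneg_left h1 hc.le
    rw [hc3]; linarith
  -- target quantity
  set m : ℕ := 2 * S.μ k with hmdef
  have hmcast : (2 * (S.μ k : ℝ)) = (m:ℝ) := by rw [hmdef]; push_cast; ring
  rw [hmcast, one_div_one_div]
  set X := (|(j:ℝ) - S.α k * n| / (n:ℝ) ^ ((1:ℝ) / (m:ℝ))) ^ ((m:ℝ) / ((m:ℝ) - 1)) with hX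
  have hX0 : 0 ≤ X := by positivity
  have hXB : X ≤ B ^ 2 * n := by
    calc X ≤ (B * n / (n:ℝ) ^ ((1:ℝ) / (m:ℝ))) ^ ((m:ℝ) / ((m:ℝ) - 1)) := by
          apply Real.rpow_le_rpow (by positivity) _ (hexpo k).1.le
          gcongr
          exact hBj k k n hn j hj1 hj2
      _ = B ^ ((m:ℝ) / ((m:ℝ) - 1)) * n := rpow_scale _ (hm2 k) B n hB0.le hn'
      _ ≤ _ := by
        gcongr
        rw [← Real.rpow_natCast]
        exact Real.rpow_le_rpow_of_exponent_le hB1 (by exact_mod_cast (hexpo k).2)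
  have hNpos : 0 < (n:ℝ) ^ ((1:ℝ) / (m:ℝ)) := by positivity
  have hNle : (n:ℝ) ^ ((1:ℝ) / (m:ℝ)) ≤ n := by
    calc _ ≤ (n:ℝ) ^ (1:ℝ) := by
          apply Real.rpow_le_rpow_of_exponent_le hn1
          have := hmr k
          rw [div_le_one (by linarith)]; linarith
      _ = n := Real.rpow_one _
  have hE : Real.exp (-c3 * n) ≤ (2 / c3) / (n:ℝ) ^ ((1:ℝ) / (m:ℝ)) * Real.exp (-c4 * X) := by
    have h1 : (n:ℝ) ≤ 2 / c3 * Real.exp (c3 * n / 2) := by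
      have := Real.add_one_le_exp (c3 * n / 2)
      calc (n:ℝ) = 2 / c3 * (c3 * n / 2) := by field_simp
        _ ≤ _ := by gcongr; linarith
    have h2 : c4 * X ≤ c3 * n / 2 := by
      calc c4 * X ≤ (c3 / (2 * B ^ 2)) * (B ^ 2 * n) := by
            gcongr; exact min_le_right _ _
        _ = _ := by field_simp
    rw [div_mul_eq_mul_div, le_div_iff₀ hNpos]
    calc Real.exp (-c3 * n) * (n:ℝ) ^ ((1:ℝ) / (m:ℝ))
        ≤ Real.exp (-c3 * n) * (2 / c3 * Real.exp (c3 * n / 2)) := by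
          gcongr; exact hNle.trans h1
      _ = 2 / c3 * Real.exp (-(c3 * n / 2)) := by
          rw [mul_left_comm, ← Real.exp_add]; congr 2; ring
      _ ≤ _ := by gcongr; linarith
  have hk : C / (n:ℝ) ^ ((1:ℝ) / (m:ℝ)) * Real.exp (-c * X) ≤
      C / (n:ℝ) ^ ((1:ℝ) / (m:ℝ)) * Real.exp (-c4 * X) := by
    gcongr
    exact min_le_left _ _
  have hs : ∑ ν ∈ Finset.univ.erase k, C / (n:ℝ) ^ ((1:ℝ) / ((2 * S.μ ν : ℕ):ℝ)) *
          Real.exp (-c * (|(j:ℝ) - S.α ν * n| / (n:ℝ) ^ ((1:ℝ) / ((2 * S.μ ν : ℕ):ℝ))) ^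
            (((2 * S.μ ν : ℕ):ℝ) / (((2 * S.μ ν : ℕ):ℝ) - 1))) ≤ S.K * (C * Real.exp (-c3 * n)) := by
    refine (Finset.sum_le_card_nsmul _ _ _ hoff).trans ?_
    rw [nsmul_eq_mul]
    gcongr
    refine (Finset.card_erase_le).trans ?_
    simp
  rw [← Finset.add_sum_erase _ _ (Finset.mem_univ k)] at hmain
  have h0 : C * Real.exp (-c * n) ≤ C * Real.exp (-c3 * n) := by gcongr
  calc _ ≤ _ := hmain
    _ ≤ C * (1 + S.K) * Real.exp (-c3 * n) +
        C / (n:ℝ) ^ ((1:ℝ) / (m:ℝ)) * Real.exp (-c4 * X) := by linarith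
    _ ≤ C * (1 + S.K) * ((2 / c3) / (n:ℝ) ^ ((1:ℝ) / (m:ℝ)) * Real.exp (-c4 * X)) +
        C / (n:ℝ) ^ ((1:ℝ) / (m:ℝ)) * Real.exp (-c4 * X) := by gcongr
    _ = _ := by ring
end
end
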